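/- arXiv:2602.03261 — 2 statements merged into one kernel-verified Lean document; each statement's English description precedes it below -/
import Mathlib

section
/- Let (K,O) be a valued field of positive characteristic, viewed as a structure in the language of rings expanded by a unary predicate for the valuation ring O, and suppose that every existential formula of this language is NIP with respect to the theory of (K,O). Then O is henselian. -/
open FirstOrder Language

namespace NIPPaper

universe u v

/-- A partitioned formula `φ(x, y)` has the independence property (IP) with respect to the
theory `T` if in some model of `T` there are sequences `(aᵢ : i < ω)` and `(b_S : S ⊆ ω)`
such that `φ(aᵢ, b_S)` holds iff `i ∈ S`. -/
def Theory.HasIP {L : FirstOrder.Language.{u, v}} (T : L.Theory) {α β : Type}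
    (φ : L.Formula (α ⊕ β)) : Prop :=
  ∃ (M : Theory.ModelType.{u, v, max u v} T) (a : ℕ → α → M) (b : Set ℕ → β → M),
    ∀ (i : ℕ) (s : Set ℕ), φ.Realize (Sum.elim (a i) (b s)) ↔ i ∈ s

/-- Prenex classes `Σₙ` (`b = true`) and `Πₙ` (`b = false`), counting alternating blocks of
quantifiers; `IsEA true 1 φ` says that `φ` is an existential formula: a block of
existential quantifiers followed by a quantifier-free formula. -/
inductive IsEA {L : FirstOrder.Language.{u, v}} :
    Bool → ℕ → ∀ {α : Type} {k : ℕ}, L.BoundedFormula α k → Prop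
  | of_isQF {b : Bool} {n : ℕ} {α : Type} {k : ℕ} {φ : L.BoundedFormula α k} :
      φ.IsQF → IsEA b n φ
  | ex {n : ℕ} {α : Type} {k : ℕ} {φ : L.BoundedFormula α (k + 1)} :
      IsEA true (n + 1) φ → IsEA true (n + 1) φ.ex
  | all {n : ℕ} {α : Type} {k : ℕ} {φ : L.BoundedFormula α (k + 1)} :
      IsEA false (n + 1) φ → IsEA false (n + 1) φ.all
  | of_flip {b : Bool} {n : ℕ} {α : Type} {k : ℕ} {φ : L.BoundedFormula α k} :
      IsEA b n φ → IsEA (!b) (n + 1) φ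

/-- Existential formulas. -/
def IsExistential {L : FirstOrder.Language.{u, v}} {α : Type} {k : ℕ}
    (φ : L.BoundedFormula α k) : Prop := IsEA true 1 φ

/-- A theory is `E`-NIP if all of its existential formulas are NIP. -/
def Theory.IsExNIP {L : FirstOrder.Language.{u, v}} (T : L.Theory) : Prop :=
  ∀ (a b : ℕ) (φ : L.Formula (Fin a ⊕ Fin b)), IsExistential φ → ¬ Theory.HasIP T φ

/-- The relation symbols of the language consisting of a single unary predicate. -/
def predRel : ℕ → Type | 1 => Unit | _ => Empty

/-- The language with one unary predicate (and no function symbols). -/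
def ovLang : FirstOrder.Language.{0, 0} :=
  { Functions := fun _ => Empty, Relations := predRel }

/-- The language of rings expanded by a unary predicate (for a valuation ring). -/
def ringPredLang : FirstOrder.Language.{0, 0} := Language.ring.sum ovLang

/-- The `ringPredLang`-structure associated to a field `K` together with a valuation
subring `O`: the ring symbols are interpreted by the field operations, and the unary
predicate by membership in `O`. -/
noncomputable def valuedFieldStructure (K : Type) [Field K] (O : ValuationSubring K) :
    ringPredLang.Structure K :=
  letI : Language.ring.Structure K := (FirstOrder.Ring.compatibleRingOfRing K).toStructure
  letI : ovLang.Structure K :=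
    { funMap := fun {n} f _ => Empty.elim f
      RelMap := fun {n} r x =>
        match n, r with
        | 1, _ => x 0 ∈ O
        | 0, r => Empty.elim r
        | (_ + 2), r => Empty.elim r }
  Language.sumStructure _ _ K

/-- The complete theory of the valued field `(K, O)` in the language of rings with a
predicate for the valuation ring. -/
noncomputable def valuedFieldTheory (K : Type) [Field K] (O : ValuationSubring K) :
    ringPredLang.Theory :=
  letI := valuedFieldStructure K O
  ringPredLang.completeTheory K


section ModelTheory

variable {L : FirstOrder.Language.{u, v}}

/-- Existentially quantifying the bound variables of an existential formula gives an existential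
formula. -/
theorem IsEA.exs {α : Type} {m : ℕ} : ∀ {n : ℕ} {φ : L.BoundedFormula α n},
    IsEA true (m + 1) φ → IsEA true (m + 1) φ.exs
  | 0, _, h => h
  | n + 1, _, h => IsEA.exs (n := n) (IsEA.ex h)

theorem isExistential_iExs {α β : Type} [Finite β] {φ : L.Formula (α ⊕ β)}
    (h : BoundedFormula.IsQF φ) : IsExistential (φ.iExs β) :=
  IsEA.exs (m := 0) (IsEA.of_isQF (h.relabel _))

theorem isQF_iInf {α ι : Type} [Finite ι] {n : ℕ} {f : ι → L.BoundedFormula α n}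
    (h : ∀ i, (f i).IsQF) : (BoundedFormula.iInf f).IsQF := by
  have key : ∀ l : List (L.BoundedFormula α n), (∀ φ ∈ l, φ.IsQF) →
      (l.foldr (· ⊓ ·) ⊤).IsQF := by
    intro l
    induction l with
    | nil => exact fun _ => BoundedFormula.IsQF.top
    | cons a l ih =>
      intro hl
      exact (hl a (by simp)).inf (ih fun φ hφ => hl φ (by simp [hφ]))
  refine key _ fun φ hφ => ?_
  obtain ⟨i, -, rfl⟩ := List.mem_map.1 hφ
  exact h i

/-- If a formula shatters arbitrarily large finite sets in a structure, then it has the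
independence property with respect to the complete theory of that structure. -/
theorem hasIP_completeTheory_of_shatters {L : FirstOrder.Language.{0, 0}} {M : Type}
    [L.Structure M] [Nonempty M] {α β : Type} (φ : L.Formula (α ⊕ β))
    (h : ∀ n : ℕ, ∃ (a : Fin n → α → M) (b : Set (Fin n) → β → M),
      ∀ i s, φ.Realize (Sum.elim (a i) (b s)) ↔ i ∈ s) :
    Theory.HasIP (L.completeTheory M) φ := by
  classical
  choose a b hab using h
  let U : Ultrafilter ℕ := Filter.hyperfilter ℕ
  let _ : Setoid (ℕ → M) := (U : Filter ℕ).productSetoid fun _ => M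
  let a' : ℕ → α → ∀ _ : ℕ, M := fun i x n =>
    if hi : i < n then a n ⟨i, hi⟩ x else Classical.arbitrary M
  let b' : Set ℕ → β → ∀ _ : ℕ, M := fun s y n => b n {i | (i : ℕ) ∈ s} y
  have hmodel : (U : Filter ℕ).Product (fun _ : ℕ => M) ⊨ L.completeTheory M := by
    refine ⟨fun ψ hψ => ?_⟩
    rw [Ultraproduct.sentence_realize]
    exact Filter.Eventually.of_forall fun _ => hψ
  refine ⟨Theory.ModelType.of _ ((U : Filter ℕ).Product fun _ : ℕ => M),
    fun i x => Quotient.mk' (a' i x), fun s y => Quotient.mk' (b' s y), fun i s => ?_⟩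
  have hcast := Ultraproduct.realize_formula_cast (u := U) (M := fun _ : ℕ => M) φ
    (Sum.elim (a' i) (b' s))
  have hfun : (fun j : α ⊕ β => (Quotient.mk' (Sum.elim (a' i) (b' s) j) :
      (U : Filter ℕ).Product fun _ : ℕ => M)) =
      Sum.elim (fun x => Quotient.mk' (a' i x)) (fun y => Quotient.mk' (b' s y)) := by
    ext j
    cases j <;> rfl
  rw [hfun] at hcast
  refine hcast.trans ?_
  have hev : ∀ᶠ n in (U : Filter ℕ),
      ((φ.Realize fun j => Sum.elim (a' i) (b' s) j n) ↔ i ∈ s) := by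
    refine (Nat.hyperfilter_le_atTop : (U : Filter ℕ) ≤ _)
      (Filter.eventually_atTop.2 ⟨i + 1, fun n hn => ?_⟩)
    have hi : i < n := hn
    have := hab n ⟨i, hi⟩ {i | (i : ℕ) ∈ s}
    rw [Set.mem_ofPred_eq] at this
    refine Iff.trans (iff_of_eq (congrArg _ ?_)) this
    ext j
    cases j with
    | inl x => simp [a', hi]
    | inr y => rfl
  rw [Filter.eventually_congr hev, Filter.eventually_const]

end ModelTheory

section ValuedField

variable {K : Type} [Field K] (O : ValuationSubring K)

theorem exists_freeCommRing_lift_eq_eval {V : Type} (P : MvPolynomial V K) :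
    ∃ s : Finset K, ∀ s' : Finset K, s ⊆ s' → ∃ F : FreeCommRing (V ⊕ s'), ∀ v : V → K,
      FreeCommRing.lift (Sum.elim v (fun x : s' => (x : K))) F = MvPolynomial.eval v P := by
  classical
  induction P using MvPolynomial.induction_on with
  | C a =>
    refine ⟨{a}, fun s' hs' => ⟨FreeCommRing.of (Sum.inr ⟨a, hs' (by simp)⟩), fun v => ?_⟩⟩
    simp
  | add P Q hP hQ =>
    obtain ⟨s, hs⟩ := hP
    obtain ⟨t, ht⟩ := hQ
    refine ⟨s ∪ t, fun s' hs' => ?_⟩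
    obtain ⟨F, hF⟩ := hs s' (Finset.union_subset_left hs')
    obtain ⟨G, hG⟩ := ht s' (Finset.union_subset_right hs')
    exact ⟨F + G, fun v => by simp [hF, hG]⟩
  | mul_X P i hP =>
    obtain ⟨s, hs⟩ := hP
    refine ⟨s, fun s' hs' => ?_⟩
    obtain ⟨F, hF⟩ := hs s' hs'
    exact ⟨F * FreeCommRing.of (Sum.inl i), fun v => by simp [hF]⟩

/-- The symbol for the valuation ring. -/
def memRel : ringPredLang.Relations 1 := Sum.inr ()

/-- The `ringPredLang`-term given by an integral polynomial. -/
noncomputable def polyTerm {V : Type} (F : FreeCommRing V) : ringPredLang.Term V :=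
  (LHom.sumInl : Language.ring →ᴸ Language.ring.sum ovLang).onTerm
    (FirstOrder.Ring.termOfFreeCommRing F)

theorem realize_polyTerm {V : Type} (F : FreeCommRing V) (v : V → K) :
    letI := valuedFieldStructure K O
    (polyTerm F).realize v = FreeCommRing.lift v F := by
  let _ := FirstOrder.Ring.compatibleRingOfRing K
  let _ : (Language.ring.sum ovLang).Structure K := valuedFieldStructure K O
  have : LHom.IsExpansionOn (LHom.sumInl : Language.ring →ᴸ Language.ring.sum ovLang) K :=
    ⟨fun _ _ => rfl, fun _ _ => rfl⟩
  have := (LHom.sumInl : Language.ring →ᴸ Language.ring.sum ovLang).realize_onTerm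
    (FirstOrder.Ring.termOfFreeCommRing F) v
  exact this.trans (FirstOrder.Ring.realize_termOfFreeCommRing F v)

theorem realize_memRel {V : Type} (t : ringPredLang.Term V) (v : V → K) :
    letI := valuedFieldStructure K O
    (memRel.formula₁ t).Realize v ↔ t.realize v ∈ O := by
  let _ := valuedFieldStructure K O
  exact Formula.realize_rel₁

/-- In an `E`-NIP valued field, a relation defined by existentially quantifying finitely many
polynomial equations and memberships in the valuation ring cannot shatter arbitrarily large finite
sets. -/
theorem exists_not_shatters (hNIP : Theory.IsExNIP (valuedFieldTheory K O))
    {α β ω ι : Type} [Finite α] [Finite β] [Finite ω] [Finite ι]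
    (P : ι → MvPolynomial ((α ⊕ β) ⊕ ω) K) (I : Set ω) :
    ∃ n : ℕ, ¬ ∃ (a : Fin n → α → K) (b : Set (Fin n) → β → K), ∀ i s,
      (∃ w : ω → K, (∀ j ∈ I, w j ∈ O) ∧
        ∀ k, MvPolynomial.eval (Sum.elim (Sum.elim (a i) (b s)) w) (P k) = 0) ↔ i ∈ s := by
  classical
  cases nonempty_fintype ι
  let _ := valuedFieldStructure K O
  by_contra! hcon
  choose s hs using fun k => exists_freeCommRing_lift_eq_eval (P k)
  let S := Finset.univ.biUnion s
  choose F hF using fun k => hs k S (Finset.subset_biUnion_of_mem s (Finset.mem_univ k))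
  let eα : α ≃ Fin (Nat.card α) := Finite.equivFin α
  let eβ : (β ⊕ S) ≃ Fin (Nat.card (β ⊕ S)) := Finite.equivFin _
  let r : ((α ⊕ β) ⊕ ω) ⊕ S → (Fin (Nat.card α) ⊕ Fin (Nat.card (β ⊕ S))) ⊕ ω :=
    Sum.elim (Sum.elim (Sum.elim (fun x => Sum.inl (Sum.inl (eα x)))
      (fun y => Sum.inl (Sum.inr (eβ (Sum.inl y))))) Sum.inr)
      (fun z => Sum.inl (Sum.inr (eβ (Sum.inr z))))
  let ψ : ringPredLang.Formula ((Fin (Nat.card α) ⊕ Fin (Nat.card (β ⊕ S))) ⊕ ω) :=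
    Formula.iInf (fun j : I => memRel.formula₁ (Term.var (Sum.inr (j : ω)))) ⊓
      Formula.iInf (fun k => ((polyTerm (F k)).relabel r).equal (polyTerm 0))
  have hψ : BoundedFormula.IsQF ψ :=
    (isQF_iInf fun j => (BoundedFormula.IsAtomic.rel _ _).isQF).inf
      (isQF_iInf fun k => (BoundedFormula.IsAtomic.equal _ _).isQF)
  refine hNIP _ _ _ (isExistential_iExs hψ) (hasIP_completeTheory_of_shatters _ fun n => ?_)
  obtain ⟨a, b, hab⟩ := hcon n
  refine ⟨fun i => a i ∘ eα.symm, fun s => Sum.elim (b s) (fun z : S => (z : K)) ∘ eβ.symm,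
    fun i s => Iff.trans ?_ (hab i s)⟩
  rw [Formula.realize_iExs]
  refine exists_congr fun w => ?_
  rw [Formula.realize_inf, Formula.realize_iInf, Formula.realize_iInf]
  refine and_congr ?_ (forall_congr' fun k => ?_)
  · rw [Subtype.forall]
    exact forall₂_congr fun j _ => realize_memRel O _ _
  · rw [Formula.realize_equal, Term.realize_relabel, realize_polyTerm, realize_polyTerm, map_zero,
      ← hF k]
    refine iff_of_eq (congrArg (fun v : _ → K => FreeCommRing.lift v (F k) = 0) ?_)
    ext x
    rcases x with ((x | y) | w) | z <;> simp [r]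

end ValuedField

section ArtinSchreier

open Polynomial Matrix

variable {F : Type*} [Field F] (p : ℕ) [hp : Fact p.Prime] [CharP F p]

/-- The Moore matrix of a family that is linearly independent over the prime field is
invertible. -/
theorem det_moore_ne_zero [Algebra (ZMod p) F] {m : ℕ} {δ : Fin m → F}
    (hδ : LinearIndependent (ZMod p) δ) :
    (Matrix.of fun j i : Fin m => δ i ^ p ^ (j : ℕ)).det ≠ 0 := by
  classical
  intro hdet
  obtain ⟨d, hd0, hd⟩ := Matrix.exists_vecMul_eq_zero_iff.2 hdet
  let Q : F[X] := ∑ j : Fin m, C (d j) * X ^ p ^ (j : ℕ)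
  have hinj : Function.Injective fun j : Fin m => p ^ (j : ℕ) := fun a b h =>
    Fin.ext (Nat.pow_right_injective hp.out.two_le h)
  have hcoeff : ∀ j : Fin m, Q.coeff (p ^ (j : ℕ)) = d j := by
    intro j
    simp only [Q, finsetSum_coeff, coeff_C_mul, coeff_X_pow]
    rw [Finset.sum_eq_single j]
    · simp
    · intro b _ hb
      rw [if_neg fun h => hb (hinj h.symm), mul_zero]
    · simp
  have hQ0 : Q ≠ 0 := fun h => hd0 (funext fun j => by rw [← hcoeff j, h]; simp)
  have hdeg : Q.degree < (p ^ m : ℕ) := by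
    refine mem_degreeLT.1 (Submodule.sum_mem _ fun j _ => mem_degreeLT.2 ?_)
    refine (degree_C_mul_X_pow_le _ _).trans_lt ?_
    exact_mod_cast Nat.pow_lt_pow_right hp.out.one_lt j.2
  have hroot : ∀ c : Fin m → ZMod p, Q.IsRoot (∑ i, c i • δ i) := by
    intro c
    have h1 : ∀ j : Fin m, (∑ i, c i • δ i) ^ p ^ (j : ℕ) = ∑ i, c i • δ i ^ p ^ (j : ℕ) := by
      intro j
      rw [sum_pow_char_pow]
      refine Finset.sum_congr rfl fun i _ => ?_
      rw [Algebra.smul_def, Algebra.smul_def, mul_pow, ← map_pow, ZMod.pow_card_pow]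
    simp only [Q, IsRoot.def, eval_finsetSum, eval_mul, eval_C, eval_pow, eval_X, h1,
      Finset.mul_sum]
    rw [Finset.sum_comm]
    refine Finset.sum_eq_zero fun i _ => ?_
    have := congrFun hd i
    simp only [vecMul, dotProduct, of_apply, Pi.zero_apply] at this
    calc ∑ j, d j * c i • δ i ^ p ^ (j : ℕ) = c i • ∑ j, d j * δ i ^ p ^ (j : ℕ) := by
          rw [Finset.smul_sum]; exact Finset.sum_congr rfl fun j _ => mul_smul_comm _ _ _
      _ = 0 := by rw [this, smul_zero]
  have hinj2 : Function.Injective fun c : Fin m → ZMod p => ∑ i, c i • δ i :=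
    hδ.fintypeLinearCombination_injective
  have hcard : p ^ m ≤ Q.roots.toFinset.card := by
    have := Finset.card_le_card_of_injOn (s := (Finset.univ : Finset (Fin m → ZMod p)))
      (t := Q.roots.toFinset) _ (fun c _ => by simpa [hQ0] using hroot c) hinj2.injOn
    simpa using this
  have h2 : Q.roots.toFinset.card < p ^ m := by
    have h3 := (Multiset.toFinset_card_le Q.roots).trans (Q.card_roots')
    exact h3.trans_lt ((natDegree_lt_iff_degree_lt hQ0).2 hdeg)
  omega

/-- A linear-algebra form of the argument of Kaplan, Scanlon and Wagner: if `c` is orthogonal to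
all Frobenius twists of an independent family `(γ₀, …, γ_{m+1})` with `γ_k = 1`, and divisibility
of `t c_i` by the Artin-Schreier map for `i ≠ k` implies that for `i = k`, then the Artin-Schreier
map is surjective. -/
theorem artinSchreier_surjective_of_orthogonal [Algebra (ZMod p) F] {m : ℕ}
    {γ c : Fin (m + 2) → F} (hγ : LinearIndependent (ZMod p) γ) (hc : c ≠ 0)
    (hγc : ∀ j : ℕ, j < m + 1 → ∑ i, c i * γ i ^ p ^ (j + 1) = 0)
    (k : Fin (m + 2)) (hk : γ k = 1)
    (h : ∀ t, (∀ i, i ≠ k → ∃ y, t * c i = y ^ p - y) → ∃ y, t * c k = y ^ p - y) (z : F) :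
    ∃ w : F, w ^ p - w = z := by
  classical
  let δ : Fin (m + 1) → F := fun i => γ (k.succAbove i) ^ p - γ (k.succAbove i)
  have hδ : LinearIndependent (ZMod p) δ := by
    rw [Fintype.linearIndependent_iff]
    intro g hg
    have h1 : (∑ i, g i • γ (k.succAbove i)) ^ p = ∑ i, g i • γ (k.succAbove i) := by
      rw [sum_pow_char, ← sub_eq_zero, ← Finset.sum_sub_distrib, ← hg]
      refine Finset.sum_congr rfl fun i _ => ?_
      rw [smul_sub, Algebra.smul_def, Algebra.smul_def, mul_pow, ← map_pow,
        ZMod.pow_card]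
    obtain ⟨n, hn⟩ := (mem_bot_iff_intCast p F).1
      ((Subfield.mem_bot_iff_pow_eq_self F p).2 h1)
    rw [Fintype.linearIndependent_iff] at hγ
    let g' : Fin (m + 2) → ZMod p := k.insertNth (-(n : ZMod p)) g
    have h2 : ∑ i, g' i • γ i = 0 := by
      rw [Fin.sum_univ_succAbove _ k]
      simp only [g', Fin.insertNth_apply_same, Fin.insertNth_apply_succAbove, hk, ← hn]
      simp [Algebra.smul_def]
    intro i
    have := hγ g' h2 (k.succAbove i)
    simpa [g'] using this
  have hδc : ∀ j : ℕ, j < m → ∑ i, c (k.succAbove i) * δ i ^ p ^ (j + 1) = 0 := by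
    intro j hj
    have h1 : ∑ i, c i * (γ i ^ p - γ i) ^ p ^ (j + 1) = 0 := by
      have : ∀ i, c i * (γ i ^ p - γ i) ^ p ^ (j + 1) =
          c i * γ i ^ p ^ (j + 1 + 1) - c i * γ i ^ p ^ (j + 1) := by
        intro i
        rw [sub_pow_char_pow, ← pow_mul, ← pow_succ', mul_sub]
      simp only [this, Finset.sum_sub_distrib, hγc j (by omega), hγc (j + 1) (by omega), sub_zero]
    rw [Fin.sum_univ_succAbove _ k, hk] at h1
    simpa [hp.out.ne_zero] using h1
  have hdet := det_moore_ne_zero p hδ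
  set A : Matrix (Fin (m + 1)) (Fin (m + 1)) F :=
    Matrix.of fun j i : Fin (m + 1) => δ i ^ p ^ (j : ℕ) with hA
  obtain ⟨x, hx⟩ : ∃ x, A *ᵥ x = fun j : Fin (m + 1) => z ^ p ^ (j : ℕ) :=
    (Matrix.mulVec_surjective_iff_isUnit.2 ((Matrix.isUnit_iff_isUnit_det A).2 hdet.isUnit)) _
  have hx' : ∀ j : ℕ, j < m + 1 → ∑ i, δ i ^ p ^ j * x i = z ^ p ^ j := fun j hj =>
    congrFun hx ⟨j, hj⟩
  let B : Matrix (Fin (m + 1)) (Fin (m + 1)) F := A.map (frobenius F p)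
  have hB : ∀ v j, (B *ᵥ v) j = ∑ i, δ i ^ p ^ ((j : ℕ) + 1) * v i := by
    intro v j
    simp only [B, hA, mulVec, dotProduct, map_apply, of_apply, frobenius_def, ← pow_mul, pow_succ]
  have hBinj : ∀ v, B *ᵥ v = 0 → v = 0 := by
    intro v hv
    refine Matrix.eq_zero_of_mulVec_eq_zero ?_ hv
    have : B.det = A.det ^ p := ((frobenius F p).map_det A).symm
    rw [this]
    exact pow_ne_zero _ hdet
  let y : Fin (m + 1) → F := fun i => x i ^ p - x i
  let c' : Fin (m + 1) → F := fun i => c (k.succAbove i)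
  have hc' : c' ≠ 0 := by
    intro h0
    refine hc (funext fun i => ?_)
    have h1 := hγc 0 (by omega)
    rw [Fin.sum_univ_succAbove _ k, hk] at h1
    have h2 : ∀ i, c (k.succAbove i) = 0 := congrFun h0
    rcases Fin.eq_self_or_eq_succAbove k i with rfl | ⟨i, rfl⟩
    · simpa [h2] using h1
    · exact h2 i
  have hBc : ∀ j : Fin (m + 1), (j : ℕ) < m → (B *ᵥ c') j = 0 := by
    intro j hj
    rw [hB, ← hδc j hj]
    exact Finset.sum_congr rfl fun i _ => mul_comm _ _
  have hBy : ∀ j : Fin (m + 1), (j : ℕ) < m → (B *ᵥ y) j = 0 := by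
    intro j hj
    have h1 : ∀ i, δ i ^ p ^ ((j : ℕ) + 1) * y i =
        (δ i ^ p ^ (j : ℕ) * x i) ^ p - δ i ^ p ^ ((j : ℕ) + 1) * x i := by
      intro i
      simp only [y]
      ring
    rw [hB]
    simp only [h1]
    rw [Finset.sum_sub_distrib, ← sum_pow_char, hx' j (by omega), hx' (j + 1) (by omega), ← pow_mul,
      ← pow_succ, sub_self]
  let u := (B *ᵥ y) (Fin.last m)
  let v := (B *ᵥ c') (Fin.last m)
  have hv : v ≠ 0 := by
    intro h0
    refine hc' (hBinj _ (funext fun j => ?_))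
    rcases Fin.eq_castSucc_or_eq_last j with ⟨j, rfl⟩ | rfl
    · exact hBc _ j.2
    · exact h0
  have hyc : y = (u / v) • c' := by
    rw [← sub_eq_zero]
    refine hBinj _ (funext fun j => ?_)
    rw [mulVec_sub, mulVec_smul]
    rcases Fin.eq_castSucc_or_eq_last j with ⟨j, rfl⟩ | rfl
    · simp only [Pi.sub_apply, Pi.smul_apply]
      rw [hBc _ j.2, hBy _ j.2]
      simp
    · change u - (u / v) * v = 0
      field_simp
      simp
  have hyc' : ∀ i, (u / v) * c (k.succAbove i) = x i ^ p - x i := fun i => (congrFun hyc i).symm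
  obtain ⟨x₀, hx₀⟩ := h (u / v) fun i hi => by
    obtain ⟨i, rfl⟩ := Fin.exists_succAbove_eq hi
    exact ⟨x i, hyc' i⟩
  refine ⟨x₀ + ∑ i, γ (k.succAbove i) * x i, ?_⟩
  have h1 : ∀ i, (γ (k.succAbove i) * x i) ^ p =
      γ (k.succAbove i) ^ p * x i + (u / v) * (c (k.succAbove i) * γ (k.succAbove i) ^ p) := by
    intro i
    have := hyc' i
    rw [mul_pow]
    linear_combination -γ (k.succAbove i) ^ p * this
  have h2 : ∑ i, c (k.succAbove i) * γ (k.succAbove i) ^ p = - c k := by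
    have := hγc 0 (by omega)
    rw [Fin.sum_univ_succAbove _ k, hk] at this
    simp only [zero_add, pow_one, one_pow, mul_one] at this
    linear_combination this
  have h3 := hx' 0 (by omega)
  simp only [pow_zero, pow_one] at h3
  rw [add_pow_char, sum_pow_char, Finset.sum_congr rfl fun i _ => h1 i, Finset.sum_add_distrib,
    ← Finset.mul_sum, h2, ← h3]
  have h4 : ∑ i, δ i * x i =
      ∑ i, γ (k.succAbove i) ^ p * x i - ∑ i, γ (k.succAbove i) * x i := by
    rw [← Finset.sum_sub_distrib]
    exact Finset.sum_congr rfl fun i _ => sub_mul _ _ _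
  rw [h4]
  linear_combination -hx₀

end ArtinSchreier

section ArtinSchreierNIP

/-- If the relation expressing that `t * c` is of the form `y ^ p - y` avoids the patterns produced
by the independence property, then the Artin-Schreier map is surjective. -/
theorem artinSchreier_surjective_of_not_pattern {F : Type*} [Field F] (p : ℕ) [Fact p.Prime]
    [CharP F p] [Infinite F] (n : ℕ)
    (h : ¬ ∃ t c : Fin n → F, ∀ i j, (∃ y, t i * c j = y ^ p - y) ↔ i ≠ j) (z : F) :
    ∃ w : F, w ^ p - w = z := by
  let _ : Algebra (ZMod p) F := ZMod.algebra F p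
  have h' : ¬ ∃ t c : Fin (n + 2) → F, ∀ i j, (∃ y, t i * c j = y ^ p - y) ↔ i ≠ j := by
    rintro ⟨t, c, htc⟩
    exact h ⟨t ∘ Fin.castAdd 2, c ∘ Fin.castAdd 2, fun i j => by simp [htc]⟩
  have hrank : ((n + 2 : ℕ) : Cardinal) ≤ Module.rank (ZMod p) F := by
    refine (Cardinal.natCast_lt_aleph0).le.trans ?_
    by_contra hlt
    have : Module.Finite (ZMod p) F := Module.rank_lt_aleph0_iff.1 (not_le.1 hlt)
    have : Finite F := Module.finite_of_finite (ZMod p)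
    exact not_finite F
  obtain ⟨β, hβ⟩ := exists_linearIndependent_of_le_rank hrank
  let A : Matrix (Fin (n + 1)) (Fin (n + 2)) F := Matrix.of fun j i => β i ^ p ^ ((j : ℕ) + 1)
  obtain ⟨c, hAc, hc⟩ := Submodule.exists_mem_ne_zero_of_ne_bot
    (LinearMap.ker_ne_bot_of_finrank_lt (f := A.mulVecLin) (by simp))
  have hβc : ∀ j : ℕ, j < n + 1 → ∑ i, c i * β i ^ p ^ (j + 1) = 0 := by
    intro j hj
    have := congrFun (LinearMap.mem_ker.1 hAc) ⟨j, hj⟩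
    simpa [A, Matrix.mulVec, dotProduct, mul_comm] using this
  by_cases hall : ∀ k, ∃ t, (∀ i, i ≠ k → ∃ y, t * c i = y ^ p - y) ∧ ¬ ∃ y, t * c k = y ^ p - y
  · choose t ht ht' using hall
    refine absurd ⟨t, c, fun i j => ⟨?_, fun hij => ht i j hij.symm⟩⟩ h'
    rintro hy rfl
    exact ht' i hy
  · push Not at hall
    obtain ⟨k, hk⟩ := hall
    have hk0 : β k ≠ 0 := hβ.ne_zero k
    refine artinSchreier_surjective_of_orthogonal p (γ := fun i => (β k)⁻¹ * β i) (c := c) ?_ hc ?_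
      k (inv_mul_cancel₀ hk0) hk z
    · exact hβ.map' (LinearMap.mulLeft (ZMod p) (β k)⁻¹)
        (LinearMap.ker_eq_bot.2 (mul_right_injective₀ (inv_ne_zero hk0)))
    · intro j hj
      rw [← mul_zero ((β k)⁻¹ ^ p ^ (j + 1)), ← hβc j hj, Finset.mul_sum]
      refine Finset.sum_congr rfl fun i _ => ?_
      ring

end ArtinSchreierNIP

section FiniteIndex

variable {R : Type*} [CommRing R]

/-- The subgroup of all `x` with `c * x ∈ G`. -/
def scaledComap (G : AddSubgroup R) (c : R) : AddSubgroup R :=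
  G.comap (AddMonoidHom.mulLeft c)

theorem mem_scaledComap {G : AddSubgroup R} {c x : R} : x ∈ scaledComap G c ↔ c * x ∈ G :=
  Iff.rfl

theorem index_scaledComap (G : AddSubgroup R) [G.FiniteIndex] (c : R) :
    (scaledComap G c).index ≠ 0 ∧ (scaledComap G c).index ≤ G.index := by
  have h0 : G.relIndex ⊤ ≠ 0 := by
    rw [AddSubgroup.relIndex_top_right]
    exact AddSubgroup.FiniteIndex.index_ne_zero
  rw [scaledComap, AddSubgroup.index_comap]
  refine ⟨mt (AddSubgroup.relIndex_eq_zero_of_le_right le_top) h0, ?_⟩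
  rw [← AddSubgroup.relIndex_top_right G]
  exact AddSubgroup.relIndex_le_of_le_right le_top h0

theorem index_iInf_scaledComap (G : AddSubgroup R) [G.FiniteIndex] (C : Finset R) :
    (⨅ c ∈ C, scaledComap G c).FiniteIndex ∧
      (⨅ c ∈ C, scaledComap G c).index ≤ G.index ^ C.card := by
  classical
  refine ⟨AddSubgroup.finiteIndex_iInf' _ fun c _ => ⟨(index_scaledComap G c).1⟩, ?_⟩
  induction C using Finset.induction with
  | empty => simp
  | insert a s ha ih =>
    rw [Finset.iInf_insert, Finset.card_insert_of_notMem ha, pow_succ']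
    exact (AddSubgroup.index_inf_le).trans
      (Nat.mul_le_mul (index_scaledComap G a).2 ih)

/-- If all residue fields of `R` are infinite and `G` is a proper subgroup of finite index, then
finite intersections of the subgroups `scaledComap G c` have unbounded index. -/
theorem exists_lt_index_iInf_scaledComap (hR : ∀ M : Ideal R, M.IsMaximal → Infinite (R ⧸ M))
    (G : AddSubgroup R) [G.FiniteIndex] (hG : G ≠ ⊤) (B : ℕ) :
    ∃ C : Finset R, B < (⨅ c ∈ C, scaledComap G c).index := by
  classical
  by_contra! hB
  have hbdd : BddAbove (Set.range fun C : Finset R => (⨅ c ∈ C, scaledComap G c).index) :=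
    ⟨B, by rintro _ ⟨C, rfl⟩; exact hB C⟩
  obtain ⟨C, hC⟩ := Nat.sSup_mem (Set.range_nonempty _) hbdd
  have hle : ∀ c, (⨅ c ∈ C, scaledComap G c) ≤ scaledComap G c := by
    intro c
    by_contra hc
    have hlt : (⨅ a ∈ insert c C, scaledComap G a) < ⨅ c ∈ C, scaledComap G c := by
      rw [Finset.iInf_insert]
      exact inf_lt_right.2 hc
    have := (index_iInf_scaledComap G (insert c C)).1
    have h1 := AddSubgroup.index_strictAnti hlt
    have h2 := le_csSup hbdd ⟨insert c C, rfl⟩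
    rw [← hC] at h2
    exact absurd h1 (not_lt.2 h2)
  let I : Ideal R :=
    { (⨅ c ∈ C, scaledComap G c).toAddSubmonoid with
      smul_mem' := by
        intro r x hx
        change r * x ∈ (⨅ c ∈ C, scaledComap G c)
        simp only [AddSubgroup.mem_iInf, mem_scaledComap]
        intro c _
        rw [← mul_assoc]
        exact hle (c * r) hx }
  have hI : I ≠ ⊤ := by
    intro h
    refine hG (top_unique fun c _ => ?_)
    have h1 : (1 : R) ∈ I := h ▸ Submodule.mem_top
    have := hle c h1
    rwa [mem_scaledComap, mul_one] at this
  obtain ⟨M, hM, hIM⟩ := Ideal.exists_le_maximal I hI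
  have := (index_iInf_scaledComap G C).1
  have hfin : (Submodule.toAddSubgroup M).FiniteIndex :=
    AddSubgroup.finiteIndex_of_le (H := ⨅ c ∈ C, scaledComap G c) hIM
  have : Finite (R ⧸ M) :=
    AddSubgroup.finite_quotient_of_finiteIndex (H := Submodule.toAddSubgroup M)
  exact (hR M hM).not_finite this

/-- A Baldwin-Saxl type statement. -/
theorem exists_pattern_of_finiteIndex (hR : ∀ M : Ideal R, M.IsMaximal → Infinite (R ⧸ M))
    (G : AddSubgroup R) [G.FiniteIndex] (hG : G ≠ ⊤) (n : ℕ) :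
    ∃ t c : Fin n → R, ∀ i j, t i * c j ∈ G ↔ i ≠ j := by
  classical
  obtain ⟨C₀, hC₀⟩ := exists_lt_index_iInf_scaledComap hR G hG (G.index ^ n)
  have hex : ∃ C : Finset R, (⨅ c ∈ C, scaledComap G c) = ⨅ c ∈ C₀, scaledComap G c := ⟨C₀, rfl⟩
  obtain ⟨C, hC, hmin⟩ := exists_minimalFor_of_wellFoundedLT
    (fun C : Finset R => (⨅ c ∈ C, scaledComap G c) = ⨅ c ∈ C₀, scaledComap G c)
    Finset.card hex
  have hcard : n < C.card := by
    by_contra! hn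
    have h1 := (index_iInf_scaledComap G C).2
    rw [hC] at h1
    exact absurd (hC₀.trans_le h1) (not_lt.2 (Nat.pow_le_pow_right
      (Nat.pos_of_ne_zero AddSubgroup.FiniteIndex.index_ne_zero) hn))
  have hx : ∀ c ∈ C, ∃ x, (∀ c' ∈ C, c' ≠ c → c' * x ∈ G) ∧ c * x ∉ G := by
    intro c hc
    by_contra! hcon
    have heq : (⨅ c' ∈ C.erase c, scaledComap G c') = ⨅ c ∈ C₀, scaledComap G c := by
      rw [← hC]
      refine le_antisymm (fun x hx => ?_) (biInf_mono fun _ => Finset.mem_of_mem_erase)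
      simp only [AddSubgroup.mem_iInf, mem_scaledComap] at hx ⊢
      intro c' hc'
      by_cases h : c' = c
      · rw [h]
        exact hcon x fun c'' h1 h2 => hx c'' (Finset.mem_erase.2 ⟨h2, h1⟩)
      · exact hx c' (Finset.mem_erase.2 ⟨h, hc'⟩)
    have := hmin heq (Finset.card_le_card (Finset.erase_subset c C))
    exact absurd (Finset.card_erase_lt_of_mem hc) (not_lt.2 this)
  choose! x hx hx' using hx
  let e : Fin n ↪ C := (Fin.castLEEmb hcard.le).trans C.equivFin.symm.toEmbedding
  refine ⟨fun i => e i, fun j => x (e j), fun i j => ⟨?_, fun hij => ?_⟩⟩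
  · rintro h rfl
    exact hx' _ (e i).2 h
  · exact hx _ (e j).2 _ (e i).2 fun h => hij (e.injective (Subtype.ext h))

end FiniteIndex

section Coordinates

open Polynomial in
theorem isIntegral_iff_exists_coeff {K : Type*} [Field K] (O : ValuationSubring K)
    {L : Type*} [Field L] [Algebra K L] [FiniteDimensional K L] (z : L) :
    IsIntegral O z ↔ ∃ a : Fin (Module.finrank K L) → K, (∀ l, a l ∈ O) ∧
      z ^ Module.finrank K L + ∑ l, algebraMap K L (a l) * z ^ (l : ℕ) = 0 := by
  set d := Module.finrank K L
  constructor
  · intro hz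
    have hdeg : (minpoly O z).natDegree ≤ d := by
      have h1 := minpoly.natDegree_le (A := K) z
      rwa [minpoly.isIntegrallyClosed_eq_field_fractions' K hz,
        (minpoly.monic hz).natDegree_map] at h1
    have hP : (minpoly O z * X ^ (d - (minpoly O z).natDegree)).Monic :=
      (minpoly.monic hz).mul (monic_X_pow _)
    have hPd : (minpoly O z * X ^ (d - (minpoly O z).natDegree)).natDegree = d := by
      rw [(minpoly.monic hz).natDegree_mul (monic_X_pow _), natDegree_X_pow]
      omega
    have h0 : aeval z (minpoly O z * X ^ (d - (minpoly O z).natDegree)) = 0 := by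
      rw [map_mul, minpoly.aeval, zero_mul]
    generalize minpoly O z * X ^ (d - (minpoly O z).natDegree) = P at hP hPd h0
    refine ⟨fun l => P.coeff l, fun l => (P.coeff l).2, ?_⟩
    rw [hP.as_sum, hPd, map_add, map_sum, ← Fin.sum_univ_eq_sum_range
      (fun l => aeval z (C (P.coeff l) * X ^ l)) d] at h0
    simp only [map_mul, map_pow, aeval_X, aeval_C] at h0
    exact h0
  · rintro ⟨a, ha, h0⟩
    refine ⟨X ^ d + ∑ l : Fin d, C (⟨a l, ha l⟩ : O) * X ^ (l : ℕ),
      monic_X_pow_add (degree_sum_fin_lt _), ?_⟩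
    simp only [eval₂_add, eval₂_X_pow, eval₂_finsetSum, eval₂_mul, eval₂_C]
    exact h0

open MvPolynomial in
theorem exists_coordinate_mvPolynomial {K L V κ : Type*} [Field K] [Field L] [Algebra K L]
    (b : Module.Basis κ K L) (P : MvPolynomial V L) (k : κ) :
    ∃ Q : MvPolynomial V K, ∀ v : V → K,
      eval v Q = b.repr (eval (fun i => algebraMap K L (v i)) P) k := by
  induction P using MvPolynomial.induction_on with
  | C a => exact ⟨C (b.repr a k), fun v => by simp⟩
  | add P₁ P₂ h₁ h₂ =>
    obtain ⟨Q₁, h₁⟩ := h₁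
    obtain ⟨Q₂, h₂⟩ := h₂
    exact ⟨Q₁ + Q₂, fun v => by simp [h₁, h₂]⟩
  | mul_X P i h =>
    obtain ⟨Q, h⟩ := h
    refine ⟨Q * X i, fun v => ?_⟩
    simp only [map_mul, eval_X, h]
    rw [mul_comm (eval _ P), ← Algebra.smul_def, map_smul, Finsupp.smul_apply, smul_eq_mul,
      mul_comm]

end Coordinates

section ArtinSchreierSubgroup

/-- The additive map `y ↦ q * y ^ p - y` in characteristic `p`. -/
def twistedArtinSchreier {A : Type*} [CommRing A] (p : ℕ) [Fact p.Prime] [CharP A p] (q : A) :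
    A →+ A :=
  (AddMonoidHom.mulLeft q).comp (frobenius A p).toAddMonoidHom - AddMonoidHom.id A

theorem twistedArtinSchreier_apply {A : Type*} [CommRing A] (p : ℕ) [Fact p.Prime] [CharP A p]
    (q y : A) : twistedArtinSchreier p q y = q * y ^ p - y := rfl

open MvPolynomial in
/-- If `(K, O)` is `E`-NIP, then subgroups of finite extensions of `K` defined through
Artin-Schreier maps and integrality conditions avoid the patterns produced by the independence
property. -/
theorem exists_not_pattern {K : Type} [Field K] (O : ValuationSubring K)
    (hNIP : Theory.IsExNIP (valuedFieldTheory K O)) (p : ℕ) [Fact p.Prime]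
    {L : Type} [Field L] [CharP L p] [Algebra K L] [FiniteDimensional K L] (q μ : L) :
    ∃ n : ℕ, ¬ ∃ t c : Fin n → L, ∀ i j,
      (∃ y, IsIntegral O (μ * y) ∧ t i * c j = q * y ^ p - y) ↔ i ≠ j := by
  classical
  set d := Module.finrank K L with hd
  let b : Module.Basis (Fin d) K L := Module.finBasis K L
  let lin (f : Fin d → (Fin d ⊕ Fin d) ⊕ (Fin d ⊕ Fin d)) :
      MvPolynomial ((Fin d ⊕ Fin d) ⊕ (Fin d ⊕ Fin d)) L := ∑ l, X (f l) * C (b l)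
  let T := lin fun l => Sum.inl (Sum.inl l)
  let S := lin fun l => Sum.inl (Sum.inr l)
  let Y := lin fun l => Sum.inr (Sum.inl l)
  let P : Bool → MvPolynomial ((Fin d ⊕ Fin d) ⊕ (Fin d ⊕ Fin d)) L := fun r =>
    bif r then T * S - (C q * Y ^ p - Y)
    else (C μ * Y) ^ d + ∑ l : Fin d, X (Sum.inr (Sum.inr l)) * (C μ * Y) ^ (l : ℕ)
  choose Q hQ using fun r k => exists_coordinate_mvPolynomial b (P r) k
  obtain ⟨n, hn⟩ := exists_not_shatters O hNIP (fun r : Bool × Fin d => Q r.1 r.2)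
    (Set.range Sum.inr)
  refine ⟨n, fun ⟨t, c, htc⟩ => hn ⟨fun i => b.equivFun (t i),
    fun s => b.equivFun (∑ j with j ∉ s, c j), fun i s => ?_⟩⟩
  let G : AddSubgroup L :=
    ((integralClosure O L).toSubring.toAddSubgroup.comap (AddMonoidHom.mulLeft μ)).map
      (twistedArtinSchreier p q)
  have hG : ∀ x, x ∈ G ↔ ∃ y, IsIntegral O (μ * y) ∧ x = q * y ^ p - y := fun x =>
    exists_congr fun y => and_congr_right fun _ => eq_comm
  simp only [← hG] at htc
  have hmem : t i * ∑ j with j ∉ s, c j ∈ G ↔ i ∈ s := by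
    rw [Finset.mul_sum]
    constructor
    · intro h
      by_contra hi
      rw [← Finset.add_sum_erase _ _ (Finset.mem_filter.2 ⟨Finset.mem_univ i, hi⟩)] at h
      refine (htc i i).1 ?_ rfl
      refine (AddSubgroup.add_mem_cancel_right G ?_).1 h
      exact G.sum_mem fun j hj => (htc i j).2 (Finset.ne_of_mem_erase hj).symm
    · intro hi
      refine G.sum_mem fun j hj => (htc i j).2 ?_
      rintro rfl
      exact (Finset.mem_filter.1 hj).2 hi
  rw [← hmem, hG]
  have heval : ∀ w : Fin d ⊕ Fin d → K,
      (∀ r : Bool × Fin d, eval (Sum.elim (Sum.elim (b.equivFun (t i))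
        (b.equivFun (∑ j with j ∉ s, c j))) w) (Q r.1 r.2) = 0) ↔
      t i * ∑ j with j ∉ s, c j = q * (b.equivFun.symm (w ∘ Sum.inl)) ^ p -
          b.equivFun.symm (w ∘ Sum.inl) ∧
        (μ * b.equivFun.symm (w ∘ Sum.inl)) ^ d +
          ∑ l, algebraMap K L (w (Sum.inr l)) *
            (μ * b.equivFun.symm (w ∘ Sum.inl)) ^ (l : ℕ) = 0 := by
    intro w
    set v := Sum.elim (Sum.elim (b.equivFun (t i)) (b.equivFun (∑ j with j ∉ s, c j))) w with hv
    have hlin : ∀ f, eval (fun l => algebraMap K L (v l)) (lin f) = b.equivFun.symm (v ∘ f) := by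
      intro f
      simp [lin, Module.Basis.equivFun_symm_apply, Algebra.smul_def]
    have hT : eval (fun l => algebraMap K L (v l)) T = t i :=
      (hlin _).trans (b.equivFun.symm_apply_apply _)
    have hS : eval (fun l => algebraMap K L (v l)) S = ∑ j with j ∉ s, c j :=
      (hlin _).trans (b.equivFun.symm_apply_apply _)
    have hY : eval (fun l => algebraMap K L (v l)) Y = b.equivFun.symm (w ∘ Sum.inl) := hlin _
    have h0 : ∀ r, (∀ k, eval v (Q r k) = 0) ↔ eval (fun l => algebraMap K L (v l)) (P r) = 0 := by
      intro r
      simp only [hQ]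
      rw [b.ext_elem_iff]
      simp
    rw [Prod.forall, Bool.forall_bool, h0, h0, and_comm]
    refine and_congr ?_ ?_
    · simp only [P, cond_true, map_sub, map_mul, map_pow, eval_C, hT, hS, hY, sub_eq_zero]
    · simp only [P, cond_false, map_add, map_mul, map_pow, map_sum, eval_C, eval_X, hY]
      rfl
  simp only [heval, isIntegral_iff_exists_coeff, Set.forall_mem_range]
  constructor
  · rintro ⟨w, hw, h1, h2⟩
    exact ⟨_, ⟨_, hw, h2⟩, h1⟩
  · rintro ⟨y, ⟨a, ha, h2⟩, h1⟩
    refine ⟨Sum.elim (b.equivFun y) a, ha, ?_⟩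
    simp only [Sum.elim_comp_inl, LinearEquiv.symm_apply_apply, Sum.elim_inr]
    exact ⟨h1, h2⟩

end ArtinSchreierSubgroup

section ArtinSchreierRing

variable {R : Type*} [CommRing R] (p : ℕ) [hp : Fact p.Prime]

theorem infinite_quotient_of_artinSchreier_surjective (hR : ∀ r : R, ∃ t, t ^ p - t = r)
    (M : Ideal R) (hM : M.IsMaximal) : Infinite (R ⧸ M) := by
  let _ : Field (R ⧸ M) := Ideal.Quotient.field M
  by_contra hfin
  have := not_infinite_iff_finite.1 hfin
  have hsurj : Function.Surjective fun x : R ⧸ M => x ^ p - x := by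
    intro r
    obtain ⟨r, rfl⟩ := Ideal.Quotient.mk_surjective r
    obtain ⟨t, rfl⟩ := hR r
    exact ⟨Ideal.Quotient.mk M t, by simp⟩
  have h01 := Finite.injective_iff_surjective.2 hsurj
    (show (1 : R ⧸ M) ^ p - 1 = 0 ^ p - 0 by simp [hp.out.ne_zero])
  exact one_ne_zero h01

variable [CharP R p]

theorem charP_quotient_of_ne_top {I : Ideal R} (hI : I ≠ ⊤) : CharP (R ⧸ I) p := by
  have : Nontrivial (R ⧸ I) := Ideal.Quotient.nontrivial_iff.2 hI
  rw [CharP.charP_iff_prime_eq_zero hp.out, ← map_natCast (Ideal.Quotient.mk I),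
    CharP.cast_eq_zero, map_zero]

theorem exists_sub_intCast_mem_of_isMaximal {M : Ideal R} [M.IsMaximal] {t : R}
    (ht : t ^ p - t ∈ M) : ∃ i : ℤ, t - i ∈ M := by
  let _ : Field (R ⧸ M) := Ideal.Quotient.field M
  have := charP_quotient_of_ne_top p (Ideal.IsMaximal.ne_top ‹M.IsMaximal›)
  have h1 : Ideal.Quotient.mk M t ^ p = Ideal.Quotient.mk M t := by
    rw [← map_pow]
    exact Ideal.Quotient.eq.2 ht
  obtain ⟨i, hi⟩ := (mem_bot_iff_intCast p (R ⧸ M)).1 ((Subfield.mem_bot_iff_pow_eq_self _ p).2 h1)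
  refine ⟨i, Ideal.Quotient.eq.1 ?_⟩
  rw [← hi, map_intCast]

theorem eq_intCast_of_pow_eq_self [IsDomain R] {t : R} (ht : t ^ p = t) : ∃ i : ℤ, t = i := by
  have hinj := IsFractionRing.injective R (FractionRing R)
  have : CharP (FractionRing R) p := charP_of_injective_algebraMap hinj p
  have h1 : algebraMap R (FractionRing R) t ^ p = algebraMap R (FractionRing R) t := by
    rw [← map_pow, ht]
  obtain ⟨i, hi⟩ := (mem_bot_iff_intCast p (FractionRing R)).1
    ((Subfield.mem_bot_iff_pow_eq_self _ p).2 h1)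
  exact ⟨i, hinj (by rw [← hi, map_intCast])⟩

theorem finiteIndex_range_twistedArtinSchreier [IsDomain R] [Finite (MaximalSpectrum R)]
    (hR : ∀ r : R, ∃ t, t ^ p - t = r) {b : R} (hb : b ∈ Ideal.jacobson (⊥ : Ideal R))
    (hb0 : b ≠ 0) : (twistedArtinSchreier p (b ^ (p - 1))).range.FiniteIndex := by
  have hpp : p - 1 + 1 = p := Nat.sub_add_cancel hp.out.one_le
  have hp2 : p - 2 + 2 = p := Nat.sub_add_cancel hp.out.two_le
  have hbM : ∀ M : MaximalSpectrum R, b ∈ M.asIdeal := fun M =>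
    (Submodule.mem_sInf.1 hb) _ ⟨bot_le, M.isMaximal⟩
  choose t ht using fun r => hR (b * r)
  have hti : ∀ r (M : MaximalSpectrum R), ∃ i : ℤ, t r - i ∈ M.asIdeal := by
    intro r M
    have := M.isMaximal
    refine exists_sub_intCast_mem_of_isMaximal p ?_
    rw [ht]
    exact M.asIdeal.mul_mem_right _ (hbM M)
  choose i hi using hti
  have key : ∀ r r', (fun M => (i r M : ZMod p)) = (fun M => (i r' M : ZMod p)) →
      r - r' ∈ (twistedArtinSchreier p (b ^ (p - 1))).range := by
    intro r r' h
    have hs : t r - t r' ∈ Ideal.jacobson (⊥ : Ideal R) := by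
      refine Submodule.mem_sInf.2 fun M hM => ?_
      have h1 : ((i r ⟨M, hM.2⟩ : ℤ) : R) = i r' ⟨M, hM.2⟩ := by
        rw [CharP.intCast_eq_intCast R p, ← ZMod.intCast_eq_intCast_iff]
        exact congrFun h ⟨M, hM.2⟩
      have h2 := M.sub_mem (hi r ⟨M, hM.2⟩) (hi r' ⟨M, hM.2⟩)
      rw [h1] at h2
      simpa using h2
    have hsb : (t r - t r') ^ p - (t r - t r') = b * (r - r') := by
      rw [sub_pow_char, mul_sub, ← ht, ← ht]
      ring
    generalize t r - t r' = s at hs hsb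
    obtain ⟨u, hu⟩ := Ideal.mem_jacobson_bot.1 hs (-s ^ (p - 2))
    have hsu : s * u = - (b * (r - r')) := by
      have h1 : s ^ p = s ^ (p - 2) * s ^ 2 := by rw [← pow_add, hp2]
      rw [← hsb, hu, h1]
      ring
    have hsy : s = b * (-(r - r') * (u⁻¹ : Rˣ)) := by
      rw [← mul_assoc, mul_neg, ← hsu, mul_assoc, Units.mul_inv, mul_one]
    generalize -(r - r') * (u⁻¹ : Rˣ) = y at hsy
    refine ⟨y, mul_left_cancel₀ hb0 ?_⟩
    rw [← hsb, hsy, twistedArtinSchreier_apply, mul_pow]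
    have h1 : b ^ p = b * b ^ (p - 1) := by rw [← pow_succ', hpp]
    rw [h1]
    ring
  rw [AddSubgroup.finiteIndex_iff_finite_quotient]
  refine Finite.of_injective
    (fun x : R ⧸ (twistedArtinSchreier p (b ^ (p - 1))).range =>
      fun M => (i x.out M : ZMod p)) fun x y hxy => ?_
  rw [← QuotientAddGroup.out_eq' x, ← QuotientAddGroup.out_eq' y, eq_comm, QuotientAddGroup.eq,
    neg_add_eq_sub]
  exact key _ _ hxy

/-- A semilocal domain of characteristic `p` with surjective Artin-Schreier map, having an element
`e` that is not congruent to an integer modulo the Jacobson radical but is so modulo every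
maximal ideal, exhibits the patterns produced by the independence property. -/
theorem exists_pattern_of_jacobson [IsDomain R] [Finite (MaximalSpectrum R)]
    (hR : ∀ r : R, ∃ t, t ^ p - t = r) {e : R}
    (he : e ^ p - e ∈ Ideal.jacobson (⊥ : Ideal R))
    (he' : ∀ i : ℤ, e - i ∉ Ideal.jacobson (⊥ : Ideal R)) (n : ℕ) :
    ∃ t c : Fin n → R, ∀ i j,
      (∃ y, t i * c j = (e ^ p - e) ^ (p - 1) * y ^ p - y) ↔ i ≠ j := by
  have hb0 : e ^ p - e ≠ 0 := by
    intro h0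
    obtain ⟨i, hi⟩ := eq_intCast_of_pow_eq_self p (sub_eq_zero.1 h0)
    refine he' i ?_
    rw [hi, sub_self]
    exact Ideal.zero_mem _
  have := finiteIndex_range_twistedArtinSchreier p hR he hb0
  have hG : (twistedArtinSchreier p ((e ^ p - e) ^ (p - 1))).range ≠ ⊤ := by
    intro htop
    obtain ⟨y, hy⟩ : (1 : R) ∈ (twistedArtinSchreier p ((e ^ p - e) ^ (p - 1))).range :=
      htop ▸ AddSubgroup.mem_top _
    rw [twistedArtinSchreier_apply] at hy
    have h1 : (e - (e ^ p - e) * y) ^ p = e - (e ^ p - e) * y := by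
      rw [sub_pow_char, mul_pow]
      have h2 : (e ^ p - e) ^ p = (e ^ p - e) * (e ^ p - e) ^ (p - 1) := by
        rw [← pow_succ', Nat.sub_add_cancel hp.out.one_le]
      rw [h2]
      linear_combination (-(e ^ p - e)) * hy
    obtain ⟨i, hi⟩ := eq_intCast_of_pow_eq_self p h1
    refine he' i ?_
    rw [← hi, sub_sub_cancel]
    exact Ideal.mul_mem_right _ _ he
  obtain ⟨t, c, htc⟩ := exists_pattern_of_finiteIndex
    (infinite_quotient_of_artinSchreier_surjective p hR) _ hG n
  refine ⟨t, c, fun i j => ?_⟩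
  rw [← htc]
  exact exists_congr fun y => eq_comm

end ArtinSchreierRing

section IntegralClosure

theorem finite_maximalSpectrum_integralClosure {K : Type*} [Field K] (O : ValuationSubring K)
    (L : Type*) [Field L] [Algebra K L] [FiniteDimensional K L] :
    Finite (MaximalSpectrum (integralClosure O L)) := by
  classical
  by_contra hfin
  have := not_finite_iff_infinite.1 hfin
  let f := Infinite.natEmbedding (MaximalSpectrum (integralClosure O L))
  let M : Fin (Module.finrank K L + 1) → Ideal (integralClosure O L) := fun i => (f i).asIdeal
  have hM : Pairwise (Function.onFun IsCoprime M) := by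
    intro i j hij
    have := (f i).isMaximal
    have := (f j).isMaximal
    refine Ideal.isCoprime_of_isMaximal fun h => hij ?_
    exact Fin.ext (f.injective (MaximalSpectrum.ext h))
  choose e he using fun i => Ideal.exists_forall_sub_mem_ideal hM (Pi.single i 1)
  have hdep : ¬ LinearIndependent K fun i => (e i : L) := by
    intro h
    have := h.fintype_card_le_finrank
    simp at this
  obtain ⟨g, hg, i₁, hi₁⟩ := Fintype.not_linearIndependent_iff.1 hdep
  obtain ⟨i₀, -, hi₀⟩ := Finset.exists_max_image Finset.univ (fun i => O.valuation (g i))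
    ⟨i₁, Finset.mem_univ _⟩
  have hg0 : g i₀ ≠ 0 := by
    intro h0
    have := hi₀ i₁ (Finset.mem_univ _)
    rw [h0, map_zero, le_zero_iff, map_eq_zero] at this
    exact hi₁ this
  have hO : ∀ i, g i / g i₀ ∈ O := by
    intro i
    rw [← O.valuation_le_one_iff, map_div₀]
    exact div_le_one_of_le₀ (hi₀ i (Finset.mem_univ _)) zero_le
  have hsum : ∑ i, (⟨g i / g i₀, hO i⟩ : O) • e i = 0 := by
    apply Subtype.ext
    have h1 : ∑ i, (g i / g i₀) • (e i : L) = 0 := by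
      rw [← smul_zero (g i₀)⁻¹, ← hg, Finset.smul_sum]
      refine Finset.sum_congr rfl fun i _ => ?_
      rw [smul_smul, div_eq_inv_mul]
    rw [← ZeroMemClass.coe_zero (integralClosure O L)] at h1
    rw [AddSubmonoidClass.coe_finsetSum]
    exact h1
  have h1 : (⟨g i₀ / g i₀, hO i₀⟩ : O) = 1 := Subtype.ext (div_self hg0)
  rw [← Finset.add_sum_erase _ _ (Finset.mem_univ i₀), h1, one_smul] at hsum
  refine (f i₀).isMaximal.ne_top ((Ideal.eq_top_iff_one _).2 ?_)
  have h2 : ∑ i ∈ Finset.univ.erase i₀, (⟨g i / g i₀, hO i⟩ : O) • e i ∈ (f i₀).asIdeal := by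
    refine Submodule.sum_mem _ fun i hi => Submodule.smul_of_tower_mem _ _ ?_
    have := he i i₀
    rwa [Pi.single_eq_of_ne (Finset.ne_of_mem_erase hi).symm, sub_zero] at this
  have h3 := he i₀ i₀
  rw [Pi.single_eq_same] at h3
  rw [eq_neg_of_add_eq_zero_left hsum] at h3
  have h4 := Submodule.add_mem _ h3 h2
  rw [← neg_mem_iff]
  convert h4 using 1
  ring

open Polynomial in
theorem exists_sub_intCast_mem_jacobson {K : Type} [Field K] [Infinite K] (O : ValuationSubring K)
    (hNIP : Theory.IsExNIP (valuedFieldTheory K O)) (p : ℕ) [hp : Fact p.Prime] [CharP K p]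
    {L : Type} [Field L] [Algebra K L] [FiniteDimensional K L] {e : integralClosure O L}
    (he : e ^ p - e ∈ Ideal.jacobson (⊥ : Ideal (integralClosure O L))) :
    ∃ i : ℤ, e - i ∈ Ideal.jacobson (⊥ : Ideal (integralClosure O L)) := by
  have : CharP L p := charP_of_injective_algebraMap (algebraMap K L).injective p
  have : CharP (integralClosure O L) p :=
    ((integralClosure O L).val.toRingHom.charP_iff Subtype.val_injective p).2 ‹CharP L p›
  have : Infinite L := Infinite.of_injective _ (algebraMap K L).injective
  have := finite_maximalSpectrum_integralClosure O L
  obtain ⟨m, hm⟩ := exists_not_pattern O hNIP p (1 : L) 0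
  have hL : ∀ z : L, ∃ w, w ^ p - w = z := by
    refine artinSchreier_surjective_of_not_pattern p m ?_
    simpa [isIntegral_zero] using hm
  have hR : ∀ r : integralClosure O L, ∃ t, t ^ p - t = r := by
    intro r
    obtain ⟨w, hw⟩ := hL r
    have hwi : IsIntegral O w := by
      have hdeg : (X ^ p - X : O[X]).natDegree = p := by
        rw [natDegree_sub_eq_left_of_natDegree_lt, natDegree_X_pow]
        rw [natDegree_X_pow, natDegree_X]
        exact hp.out.one_lt
      have hmonic : (X ^ p - X : O[X]).Monic :=
        monic_X_pow_sub (degree_X_le.trans_lt (by exact_mod_cast hp.out.one_lt))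
      refine IsIntegral.of_aeval_monic hmonic (by rw [hdeg]; exact hp.out.ne_zero) ?_
      rw [map_sub, map_pow, aeval_X, hw]
      exact r.2
    exact ⟨⟨w, hwi⟩, Subtype.ext hw⟩
  by_contra! hcon
  obtain ⟨n, hn⟩ := exists_not_pattern O hNIP p
    (((e ^ p - e) ^ (p - 1) : integralClosure O L) : L) 1
  obtain ⟨t, c, htc⟩ := exists_pattern_of_jacobson p hR he hcon n
  refine hn ⟨fun i => t i, fun j => c j, fun i j => ?_⟩
  rw [← htc]
  constructor
  · rintro ⟨y, hy, h⟩
    rw [one_mul] at hy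
    exact ⟨⟨y, hy⟩, Subtype.ext h⟩
  · rintro ⟨y, h⟩
    refine ⟨y, by rw [one_mul]; exact y.2, congrArg Subtype.val h⟩

end IntegralClosure

section Henselian

open Polynomial IsLocalRing

theorem exists_isMaximal_aeval_mem_iff {A S : Type*} [CommRing A] [IsLocalRing A] [CommRing S]
    [Algebra A S] [Algebra.IsIntegral A S] {β : S} {g : A[X]}
    (hker : ∀ Q : A[X], aeval β Q = 0 → g ∣ Q) {N : Ideal (ResidueField A)[X]} (hN : N.IsMaximal)
    (hgN : g.map (residue A) ∈ N) :
    ∃ M : Ideal S, M.IsMaximal ∧ ∀ Q : A[X], aeval β Q ∈ M ↔ Q.map (residue A) ∈ N := by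
  let _ : Algebra A[X] S := (aeval β : A[X] →ₐ[A] S).toRingHom.toAlgebra
  have : IsScalarTower A A[X] S := IsScalarTower.of_algebraMap_eq fun a => (aeval_C β a).symm
  have : Algebra.IsIntegral A[X] S := Algebra.IsIntegral.tower_top A
  have hP : (N.comap (mapRingHom (residue A))).IsMaximal :=
    Ideal.comap_isMaximal_of_surjective _ (map_surjective _ residue_surjective)
  obtain ⟨M, hM, hMN⟩ := Ideal.exists_ideal_over_maximal_of_isIntegral (S := S)
    (N.comap (mapRingHom (residue A))) fun Q hQ => by
      obtain ⟨Q', rfl⟩ := hker Q hQ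
      rw [Ideal.mem_comap, map_mul]
      exact N.mul_mem_right _ hgN
  refine ⟨M, hM, fun Q => ?_⟩
  change Q ∈ M.comap (algebraMap A[X] S) ↔ _
  rw [hMN]
  rfl

/-- A monic polynomial `g` of degree greater than one over a local ring, having a simple root in
the residue field, yields an element of any integral extension generated by a root of `g` which is
idempotent modulo the Jacobson radical, but not congruent to an integer. -/
theorem exists_mem_jacobson_of_simple_root {A S : Type*} [CommRing A] [IsLocalRing A] [CommRing S]
    [Algebra A S] [Algebra.IsIntegral A S] {β : S} {g : A[X]} (hg : g.Monic)
    (hdeg : 1 < g.natDegree) (hβ : aeval β g = 0) (hker : ∀ Q : A[X], aeval β Q = 0 → g ∣ Q)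
    {a : A} (ha : g.eval a ∈ maximalIdeal A) (ha' : IsUnit (g.derivative.eval a)) {p : ℕ}
    (hp : p ≠ 0) :
    ∃ e : S, e ^ p - e ∈ Ideal.jacobson (⊥ : Ideal S) ∧
      ∀ i : ℤ, e - i ∉ Ideal.jacobson (⊥ : Ideal S) := by
  obtain ⟨h, hh⟩ : ∃ h, g = (X - C a) * h + C (g.eval a) := by
    refine ⟨g /ₘ (X - C a), ?_⟩
    rw [X_sub_C_mul_divByMonic_eq_sub_modByMonic, modByMonic_X_sub_C_eq_C_eval, sub_add_cancel]
  have hha : h.eval a = g.derivative.eval a := by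
    rw [hh]
    simp
  obtain ⟨u, hu⟩ := ha'
  rw [← hu] at hha
  obtain ⟨H, hH⟩ : X - C a ∣ C (↑u⁻¹ : A) * h - 1 := by
    rw [dvd_iff_isRoot]
    simp [hha]
  have hres : residue A (g.eval a) = 0 := (residue_eq_zero_iff _).2 ha
  have hgres : g.map (residue A) = (X - C (residue A a)) * h.map (residue A) := by
    conv_lhs => rw [hh]
    simp [hres]
  have hhunit : ¬ IsUnit (h.map (residue A)) := by
    intro hunit
    have h1 := congrArg natDegree hgres
    rw [hg.natDegree_map, natDegree_mul (X_sub_C_ne_zero _) hunit.ne_zero, natDegree_X_sub_C,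
      natDegree_eq_zero_of_isUnit hunit] at h1
    omega
  refine ⟨aeval β (C (↑u⁻¹ : A) * h), ?_, fun i hi => ?_⟩
  · refine Submodule.mem_sInf.2 fun (M : Ideal S) ⟨_, hM⟩ => ?_
    have hMA : ∀ x ∈ maximalIdeal A, algebraMap A S x ∈ M := by
      intro x hx
      rw [← eq_maximalIdeal (Ideal.isMaximal_comap_of_isIntegral_of_isMaximal (R := A) M)] at hx
      exact hx
    set e := aeval β (C (↑u⁻¹ : A) * h) with he
    have he1 : e * (e - 1) = - algebraMap A S (g.eval a) * (algebraMap A S ↑u⁻¹ * aeval β H) := by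
      have h1 : e - 1 = aeval β ((X - C a) * H) := by
        rw [← hH, he, map_sub, map_one]
      have h2 := hβ
      rw [hh] at h2
      rw [h1, he]
      simp only [map_mul, map_add, map_sub, aeval_X, aeval_C] at h2 ⊢
      linear_combination (algebraMap A S ↑u⁻¹ * aeval β H) * h2
    have he2 : e * (e - 1) ∈ M := by
      rw [he1]
      exact M.mul_mem_right _ (M.neg_mem (hMA _ ha))
    rcases hM.isPrime.mem_or_mem he2 with h1 | h1
    · exact M.sub_mem (M.pow_mem_of_mem h1 _ (Nat.pos_of_ne_zero hp)) h1
    · rw [← Ideal.Quotient.eq] at h1 ⊢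
      rw [map_pow, h1, map_one, one_pow]
  · have key : ∀ N : Ideal (ResidueField A)[X], N.IsMaximal → g.map (residue A) ∈ N →
        C (residue A ↑u⁻¹) * h.map (residue A) - C (i : ResidueField A) ∈ N := by
      intro N hN hgN
      obtain ⟨M, hM, hMN⟩ := exists_isMaximal_aeval_mem_iff hker hN hgN
      have h1 := (Submodule.mem_sInf.1 hi) M ⟨bot_le, hM⟩
      have h2 := (hMN (C (↑u⁻¹ : A) * h - C (i : A))).1 (by simpa using h1)
      simpa using h2
    have hunit : ∀ (N : Ideal (ResidueField A)[X]) (x : ResidueField A), N.IsMaximal → C x ∈ N →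
        x = 0 := by
      intro N x hN hx
      by_contra hx0
      exact hN.ne_top (Ideal.eq_top_of_isUnit_mem _ hx (isUnit_C.2 (isUnit_iff_ne_zero.2 hx0)))
    obtain ⟨N₁, hN₁, h₁⟩ := exists_max_ideal_of_mem_nonunits
      (not_isUnit_X_sub_C (residue A a))
    obtain ⟨N₂, hN₂, h₂⟩ := exists_max_ideal_of_mem_nonunits hhunit
    have hi₁ : 1 - (i : ResidueField A) = 0 := by
      refine hunit N₁ _ hN₁ ?_
      have h1 := key N₁ hN₁ (hgres ▸ N₁.mul_mem_right _ h₁)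
      have h2 : C (residue A ↑u⁻¹) * h.map (residue A) - 1 =
          (X - C (residue A a)) * H.map (residue A) := by
        have := congrArg (Polynomial.map (residue A)) hH
        simpa using this
      have h3 : C (1 - (i : ResidueField A)) =
          (C (residue A ↑u⁻¹) * h.map (residue A) - C (i : ResidueField A)) -
          (X - C (residue A a)) * H.map (residue A) := by
        rw [← h2, map_sub, map_one]
        ring
      rw [h3]
      exact N₁.sub_mem h1 (N₁.mul_mem_right _ h₁)
    have hi₂ : (i : ResidueField A) = 0 := by
      refine hunit N₂ _ hN₂ ?_
      have h1 := key N₂ hN₂ (hgres ▸ N₂.mul_mem_left _ h₂)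
      exact (Submodule.sub_mem_iff_right _ (N₂.mul_mem_left _ h₂)).1 h1
    rw [hi₂, sub_zero] at hi₁
    exact one_ne_zero hi₁

theorem natDegree_le_one_of_irreducible {K : Type} [Field K] [Infinite K] (O : ValuationSubring K)
    (hNIP : Theory.IsExNIP (valuedFieldTheory K O)) (p : ℕ) [hp : Fact p.Prime] [CharP K p]
    {g : O[X]} (hg : g.Monic) (hirr : Irreducible g) {a : O} (ha : g.eval a ∈ maximalIdeal O)
    (ha' : IsUnit (g.derivative.eval a)) : g.natDegree ≤ 1 := by
  by_contra! hdeg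
  have hirrK : Irreducible (g.map (algebraMap O K)) :=
    hg.irreducible_iff_irreducible_map_fraction_map.1 hirr
  obtain ⟨L, _, _, hfin, α, hα⟩ : ∃ (L : Type) (_ : Field L) (_ : Algebra K L),
      FiniteDimensional K L ∧ ∃ α : L, aeval α (g.map (algebraMap O K)) = 0 := by
    have : Fact (Irreducible (g.map (algebraMap O K))) := ⟨hirrK⟩
    exact ⟨AdjoinRoot (g.map (algebraMap O K)), inferInstance, inferInstance,
      (hg.map _).finite_adjoinRoot, AdjoinRoot.root _,
      by rw [AdjoinRoot.aeval_eq, AdjoinRoot.mk_self]⟩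
  have hmin : g.map (algebraMap O K) = minpoly K α :=
    minpoly.eq_of_irreducible_of_monic hirrK hα (hg.map _)
  have hgα : aeval α g = 0 := by rwa [aeval_map_algebraMap] at hα
  let β : integralClosure O L := ⟨α, g, hg, hgα⟩
  have hval : ∀ Q : O[X], ((aeval β Q : integralClosure O L) : L) = aeval α Q := fun Q =>
    (aeval_algHom_apply (integralClosure O L).val β Q).symm
  have hker : ∀ Q : O[X], aeval β Q = 0 → g ∣ Q := by
    intro Q hQ
    rw [← map_dvd_map (algebraMap O K) (FaithfulSMul.algebraMap_injective O K) hg, hmin]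
    refine minpoly.dvd K α ?_
    rw [aeval_map_algebraMap, ← hval, hQ]
    rfl
  obtain ⟨e, he, he'⟩ := exists_mem_jacobson_of_simple_root hg hdeg
    (Subtype.ext ((hval g).trans hgα)) hker ha ha' hp.out.ne_zero
  obtain ⟨i, hi⟩ := exists_sub_intCast_mem_jacobson O hNIP p he
  exact he' i hi

theorem exists_root_of_simple_root {K : Type} [Field K] [Infinite K] (O : ValuationSubring K)
    (hNIP : Theory.IsExNIP (valuedFieldTheory K O)) (p : ℕ) [hp : Fact p.Prime] [CharP K p]
    {a : O} (f : O[X]) (hf : f.Monic) (ha : f.eval a ∈ maximalIdeal O)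
    (ha' : IsUnit (f.derivative.eval a)) : ∃ x, f.IsRoot x ∧ x - a ∈ maximalIdeal O := by
  induction hd : f.natDegree using Nat.strong_induction_on generalizing f with
  | _ d ih =>
  subst hd
  by_cases hirr : Irreducible f
  · have h1 := natDegree_le_one_of_irreducible O hNIP p hf hirr ha ha'
    have h2 : f.natDegree ≠ 0 := fun h => hirr.not_isUnit (by
      rw [hf.natDegree_eq_zero.1 h]
      exact isUnit_one)
    have h3 := hf.eq_X_add_C (by omega : f.natDegree = 1)
    refine ⟨-f.coeff 0, ?_, ?_⟩
    · rw [h3]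
      simp
    · rw [h3] at ha
      rw [← neg_mem_iff]
      simpa [add_comm] using ha
  · have hf1 : f ≠ 1 := by
      rintro rfl
      simp at ha'
    rw [hf.irreducible_iff_natDegree'] at hirr
    push Not at hirr
    obtain ⟨g, h, hg, hh, rfl, hdeg⟩ := hirr hf1
    rw [hg.natDegree_mul hh, Finset.mem_Ioc] at hdeg
    rw [hg.natDegree_mul hh] at ih
    rw [eval_mul] at ha
    have hder : (g * h).derivative.eval a =
        g.derivative.eval a * h.eval a + g.eval a * h.derivative.eval a := by simp
    have hunit : ∀ x y : O, x ∈ maximalIdeal O → IsUnit (x + y) → IsUnit y := by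
      intro x y hx hxy
      by_contra hy
      exact (mem_maximalIdeal _).1 (Ideal.add_mem _ hx ((mem_maximalIdeal _).2 hy)) hxy
    rw [hder] at ha'
    rcases (maximalIdeal.isMaximal O).isPrime.mem_or_mem ha with h1 | h1
    · rw [add_comm] at ha'
      obtain ⟨x, hx, hxa⟩ := ih g.natDegree (by omega) g hg h1
        (isUnit_of_mul_isUnit_left (hunit _ _ (Ideal.mul_mem_right _ _ h1) ha')) rfl
      exact ⟨x, root_mul_right_of_isRoot _ hx, hxa⟩
    · obtain ⟨x, hx, hxa⟩ := ih h.natDegree (by omega) h hh h1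
        (isUnit_of_mul_isUnit_right (hunit _ _ (Ideal.mul_mem_left _ _ h1) ha')) rfl
      exact ⟨x, root_mul_left_of_isRoot _ hx, hxa⟩

end Henselian

/-- **Statement 1.** Let `(K, O)` be a valued field of positive characteristic, viewed as a
structure in the language of rings expanded by a unary predicate for the valuation ring
`O`, and suppose that every existential formula of this language is NIP with respect to
the theory of `(K, O)`.  Then `O` is henselian. -/
theorem henselian_of_exNIP_of_char_pos
    (K : Type) [Field K] (O : ValuationSubring K)
    (p : ℕ) (hp : p.Prime) (hchar : CharP K p)
    (hNIP : Theory.IsExNIP (valuedFieldTheory K O)) :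
    HenselianLocalRing O := by
  have : Fact p.Prime := ⟨hp⟩
  refine ⟨fun f hf a ha ha' => ?_⟩
  cases finite_or_infinite K with
  | inl h =>
    have hO : IsField O := Finite.isField_of_domain O
    rw [IsLocalRing.isField_iff_maximalIdeal_eq.1 hO, Ideal.mem_bot] at ha
    exact ⟨a, ha, by rw [sub_self]; exact Ideal.zero_mem _⟩
  | inr h => exact exists_root_of_simple_root O hNIP p f hf ha ha'

end NIPPaper
end

section
/- (Indiscernible λ-resolution.) Let M be a λ-field of characteristic exponent p, let N ≥ 1, let a_{<ω} be an indiscernible sequence of N-tuples of M and let b be a finite tuple of parameters from M. For every L_λ-term t(x,y) there exist a rational function f over F_p, a natural number l < ω, an indiscernible sequence (α_n)_{n≥l} of tuples of M and a finite tuple d of parameters from M such that: (1) for every coordinate index k of α_l there is a 0-definable function g_k with α_{n,k} = g_k(a_n, a_{<l}) for all n ≥ l; and (2) t(a_n, b) = f(α_n, d) for all sufficiently large n ≥ l. -/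
open FirstOrder Language

namespace NIPPaper

/-- The characteristic exponent of a field: `p` if the characteristic is a prime `p`, and
`1` if the characteristic is `0`. -/
noncomputable def pexp (M : Type*) [Field M] : ℕ := max (ringChar M) 1

/-- The set `Mon(n)` of (exponent tuples of) monomials in `n` variables with all exponents
`< p`, where `p` is the characteristic exponent. -/
def Mon (M : Type*) [Field M] (n : ℕ) : Type := Fin n → Fin (pexp M)

noncomputable instance (M : Type*) [Field M] (n : ℕ) : Fintype (Mon M n) := by unfold Mon; infer_instance

/-- The value of the monomial `x^m`. -/
def monVal {M : Type*} [Field M] {n : ℕ} (x : Fin n → M) (m : Mon M n) : M :=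
  ∏ i, x i ^ (m i : ℕ)

/-- The monomial set `Mon(x)` of `x` is linearly independent over `M^p`. -/
def MonPIndep {M : Type*} [Field M] {n : ℕ} (x : Fin n → M) : Prop :=
  ∀ c : Mon M n → M, (∑ m, c m ^ pexp M * monVal x m) = 0 → ∀ m, c m = 0

/-- `t` lies in the `M^p`-span of `Mon(x)`. -/
def InPSpan {M : Type*} [Field M] {n : ℕ} (t : M) (x : Fin n → M) : Prop :=
  ∃ c : Mon M n → M, t = ∑ m, c m ^ pexp M * monVal x m

open Classical in
/-- The parameterized `λ`-function `λ_{n,m}(t; x)`: if the monomial set of `x` is linearly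
independent over `M^p` and `t` lies in its `M^p`-span, the (unique, by Frobenius
injectivity) coefficient `c_m` with `t = ∑_{m ∈ Mon(n)} c_m^p x^m`; and `0` otherwise. -/
noncomputable def lamFun (M : Type*) [Field M] {n : ℕ} (mm : Fin n → ℕ) (t : M)
    (x : Fin n → M) : M :=
  if h : (∀ i, mm i < pexp M) ∧ MonPIndep x ∧ InPSpan t x then
    Classical.choose h.2.2 (fun i => (⟨mm i, h.1 i⟩ : Fin (pexp M)))
  else 0

/-- The function symbols for the parameterized `λ`-functions: for each `n ≥ 1` and each
exponent tuple `m` of length `n`, a symbol `λ_{n,m}` of arity `n + 1`. -/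
def lamFuncSym : ℕ → Type
  | (n + 2) => Fin (n + 1) → ℕ
  | _ => Empty

/-- The language consisting of the parameterized `λ`-function symbols. -/
def lamSymLang : FirstOrder.Language.{0, 0} :=
  { Functions := lamFuncSym, Relations := fun _ => Empty }

/-- The language `L_λ` of rings expanded by the parameterized `λ`-functions. -/
def lamRingLang : FirstOrder.Language.{0, 0} := Language.ring.sum lamSymLang

/-- The canonical `L_λ`-structure on a field `M` (a `λ`-field): ring symbols are
interpreted by the field operations and the `λ`-symbols by the parameterized
`λ`-functions. -/
noncomputable def lamStructure (M : Type*) [Field M] : lamRingLang.Structure M :=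
  letI : Language.ring.Structure M := (FirstOrder.Ring.compatibleRingOfRing M).toStructure
  letI : lamSymLang.Structure M :=
    { funMap := fun {k} f xs =>
        match k, f, xs with
        | (_ + 2), mm, xs => lamFun M mm (xs 0) (fun i => xs i.succ)
        | 0, f, _ => Empty.elim f
        | 1, f, _ => Empty.elim f
      RelMap := fun {_} r _ => Empty.elim r }
  Language.sumStructure _ _ M

/-- An indiscernible sequence of tuples (indexed by `γ`) in an `L`-structure `M`. -/
def IsIndiscernible {L : FirstOrder.Language.{u, v}} {M : Type w} [L.Structure M]
    {γ : Type} (a : ℕ → γ → M) : Prop :=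
  ∀ (n : ℕ) (i j : Fin n → ℕ), StrictMono i → StrictMono j →
    ∀ φ : L.Formula (Fin n × γ),
      (φ.Realize fun p => a (i p.1) p.2) ↔ (φ.Realize fun p => a (j p.1) p.2)

/-- An indiscernible sequence of `N`-tuples of the `λ`-field `M`. -/
noncomputable def LamIndiscernible (M : Type*) [Field M] {N : ℕ}
    (a : ℕ → Fin N → M) : Prop :=
  letI := lamStructure M
  IsIndiscernible (L := lamRingLang) a

/-- A `0`-definable function of a `λ`-field, taking an `N`-tuple and an `l × N`-tuple of
arguments. -/
noncomputable def LamDefinableFun (M : Type*) [Field M] (N l : ℕ)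
    (g : (Fin N → M) → (Fin l → Fin N → M) → M) : Prop :=
  letI := lamStructure M
  ∃ φ : lamRingLang.Formula ((Fin N ⊕ Fin l × Fin N) ⊕ Unit),
    ∀ (u : Fin N → M) (v : Fin l → Fin N → M) (y : M),
      φ.Realize (Sum.elim (Sum.elim u fun p => v p.1 p.2) fun _ => y) ↔ g u v = y

/-- Realization of an `L_λ`-term in the `λ`-field `M`. -/
noncomputable def lamTermRealize {M : Type*} [Field M] {γ : Type}
    (v : γ → M) (t : lamRingLang.Term γ) : M :=
  letI := lamStructure M
  t.realize v

section Definability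

attribute [local instance] lamStructure

variable {M : Type} [Field M] {ι κ : Type}

/-- `f` is the function on tuples induced by some `L_λ`-term. -/
def IsTermFun (f : (κ → M) → M) : Prop :=
  ∃ t : lamRingLang.Term κ, ∀ v : κ → M, t.realize v = f v

/-- `X` is a `0`-definable predicate on tuples of a `λ`-field. -/
def IsDefPred (X : (κ → M) → Prop) : Prop :=
  ∃ φ : lamRingLang.Formula κ, ∀ v : κ → M, φ.Realize v ↔ X v

/-- `f` is a `0`-definable function on tuples of a `λ`-field. -/
def IsDefFun (f : (κ → M) → M) : Prop :=
  IsDefPred fun w : κ ⊕ Unit → M => f (w ∘ Sum.inl) = w (Sum.inr ())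

namespace IsTermFun

theorem var (i : κ) : IsTermFun fun v : κ → M => v i :=
  ⟨Term.var i, fun _ => rfl⟩

theorem zero : IsTermFun fun _ : κ → M => 0 :=
  ⟨Term.func (Sum.inl FirstOrder.ringFunc.zero : lamRingLang.Functions 0) Fin.elim0, fun _ => rfl⟩

theorem one : IsTermFun fun _ : κ → M => 1 :=
  ⟨Term.func (Sum.inl FirstOrder.ringFunc.one : lamRingLang.Functions 0) Fin.elim0, fun _ => rfl⟩

theorem neg {f : (κ → M) → M} (hf : IsTermFun f) : IsTermFun fun v => -f v := by
  obtain ⟨s, hs⟩ := hf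
  exact ⟨Term.func (Sum.inl FirstOrder.ringFunc.neg : lamRingLang.Functions 1) ![s],
    fun v => congrArg (- ·) (hs v)⟩

theorem add {f g : (κ → M) → M} (hf : IsTermFun f) (hg : IsTermFun g) :
    IsTermFun fun v => f v + g v := by
  obtain ⟨s, hs⟩ := hf
  obtain ⟨t, ht⟩ := hg
  exact ⟨Term.func (Sum.inl FirstOrder.ringFunc.add : lamRingLang.Functions 2) ![s, t],
    fun v => congrArg₂ (· + ·) (hs v) (ht v)⟩

theorem mul {f g : (κ → M) → M} (hf : IsTermFun f) (hg : IsTermFun g) :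
    IsTermFun fun v => f v * g v := by
  obtain ⟨s, hs⟩ := hf
  obtain ⟨t, ht⟩ := hg
  exact ⟨Term.func (Sum.inl FirstOrder.ringFunc.mul : lamRingLang.Functions 2) ![s, t],
    fun v => congrArg₂ (· * ·) (hs v) (ht v)⟩

theorem pow {f : (κ → M) → M} (hf : IsTermFun f) (n : ℕ) : IsTermFun fun v => f v ^ n := by
  induction n with
  | zero => simpa using one
  | succ n ih => simpa only [pow_succ] using ih.mul hf

theorem sum {β : Type} (s : Finset β) {f : β → (κ → M) → M} (hf : ∀ b, IsTermFun (f b)) :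
    IsTermFun fun v => ∑ b ∈ s, f b v := by
  classical
  induction s using Finset.induction_on with
  | empty => simpa using zero
  | insert b s hb ih => simpa only [Finset.sum_insert hb] using (hf b).add ih

theorem isDefPred_eq {f g : (κ → M) → M} (hf : IsTermFun f) (hg : IsTermFun g) :
    IsDefPred fun v => f v = g v := by
  obtain ⟨s, hs⟩ := hf
  obtain ⟨t, ht⟩ := hg
  exact ⟨s.equal t, fun v => by rw [Formula.realize_equal, hs, ht]⟩

theorem comp {f : (ι → M) → M} (hf : IsTermFun f) (e : ι → κ) :
    IsTermFun fun v : κ → M => f (v ∘ e) := by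
  obtain ⟨s, hs⟩ := hf
  exact ⟨s.relabel e, fun v => by rw [Term.realize_relabel, hs]⟩

theorem isDefFun {f : (κ → M) → M} (hf : IsTermFun f) : IsDefFun f :=
  (hf.comp Sum.inl).isDefPred_eq (var _)

end IsTermFun

namespace IsDefPred

theorem not {X : (κ → M) → Prop} (hX : IsDefPred X) : IsDefPred fun v => ¬X v := by
  obtain ⟨φ, hφ⟩ := hX
  exact ⟨φ.not, fun v => by rw [Formula.realize_not, hφ]⟩

theorem imp {X Y : (κ → M) → Prop} (hX : IsDefPred X) (hY : IsDefPred Y) :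
    IsDefPred fun v => X v → Y v := by
  obtain ⟨φ, hφ⟩ := hX
  obtain ⟨ψ, hψ⟩ := hY
  exact ⟨φ.imp ψ, fun v => by rw [Formula.realize_imp, hφ, hψ]⟩

theorem and {X Y : (κ → M) → Prop} (hX : IsDefPred X) (hY : IsDefPred Y) :
    IsDefPred fun v => X v ∧ Y v := by
  obtain ⟨φ, hφ⟩ := hX
  obtain ⟨ψ, hψ⟩ := hY
  exact ⟨φ ⊓ ψ, fun v => by rw [Formula.realize_inf, hφ, hψ]⟩

theorem or {X Y : (κ → M) → Prop} (hX : IsDefPred X) (hY : IsDefPred Y) :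
    IsDefPred fun v => X v ∨ Y v := by
  simpa only [or_iff_not_imp_left] using hX.not.imp hY

theorem forall_finite {β : Type} [Finite β] {X : β → (κ → M) → Prop}
    (hX : ∀ b, IsDefPred (X b)) : IsDefPred fun v => ∀ b, X b v := by
  choose φ hφ using hX
  exact ⟨Formula.iInf φ, fun v => by simp only [Formula.realize_iInf, hφ]⟩

theorem comp {X : (ι → M) → Prop} (hX : IsDefPred X) (e : ι → κ) :
    IsDefPred fun v : κ → M => X (v ∘ e) := by
  obtain ⟨φ, hφ⟩ := hX
  exact ⟨φ.relabel e, fun v => by rw [Formula.realize_relabel, hφ]⟩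

theorem exists_tuple [Finite ι] {X : (κ ⊕ ι → M) → Prop} (hX : IsDefPred X) :
    IsDefPred fun v : κ → M => ∃ z : ι → M, X (Sum.elim v z) := by
  obtain ⟨φ, hφ⟩ := hX
  exact ⟨φ.iExs ι, fun v => by simp only [Formula.realize_iExs, hφ]⟩

theorem forall_tuple [Finite ι] {X : (κ ⊕ ι → M) → Prop} (hX : IsDefPred X) :
    IsDefPred fun v : κ → M => ∀ z : ι → M, X (Sum.elim v z) := by
  obtain ⟨φ, hφ⟩ := hX
  exact ⟨φ.iAlls ι, fun v => by simp only [Formula.realize_iAlls, hφ]⟩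

theorem comp_defFun [Finite ι] {X : (ι → M) → Prop} (hX : IsDefPred X)
    {h : ι → (κ → M) → M} (hh : ∀ i, IsDefFun (h i)) :
    IsDefPred fun v : κ → M => X fun i => h i v := by
  have key : IsDefPred fun v : κ → M => ∃ z : ι → M, (∀ i, h i v = z i) ∧ X z :=
    exists_tuple (X := fun w : κ ⊕ ι → M =>
      (∀ i, h i (w ∘ Sum.inl) = w (Sum.inr i)) ∧ X (w ∘ Sum.inr))
      ((forall_finite fun i => (hh i).comp (Sum.map id fun _ => i)).and (hX.comp Sum.inr))
  have e : ∀ v : κ → M, (∃ z : ι → M, (∀ i, h i v = z i) ∧ X z) ↔ X fun i => h i v :=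
    fun v => ⟨fun ⟨z, hz, hX⟩ => by rwa [funext hz], fun hX => ⟨_, fun _ => rfl, hX⟩⟩
  simpa only [e] using key

end IsDefPred

open Classical in
/-- The function sending `v` to the unique `z` with `Y (v, z)`, if there is one, and to `0`
otherwise. -/
noncomputable def uniqueOrZero (Y : (κ ⊕ Unit → M) → Prop) (v : κ → M) : M :=
  if h : ∃! z : M, Y (Sum.elim v fun _ => z) then h.choose else 0

theorem uniqueOrZero_eq {Y : (κ ⊕ Unit → M) → Prop} {v : κ → M} {z : M}
    (hz : Y (Sum.elim v fun _ => z)) (hu : ∀ z', Y (Sum.elim v fun _ => z') → z' = z) :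
    uniqueOrZero Y v = z := by
  have h : ∃! z : M, Y (Sum.elim v fun _ => z) := ⟨z, hz, hu⟩
  rw [uniqueOrZero, dif_pos h]
  exact hu _ h.choose_spec.1

theorem uniqueOrZero_eq_iff {Y : (κ ⊕ Unit → M) → Prop} {v : κ → M} {z : M} :
    uniqueOrZero Y v = z ↔
      (Y (Sum.elim v fun _ => z) ∧
        ∀ z' : Unit → M, Y (Sum.elim v z') → z' () = z) ∨
      ((¬∃ y : Unit → M, Y (Sum.elim v y) ∧
        ∀ z' : Unit → M, Y (Sum.elim v z') → z' () = y ()) ∧ z = 0) := by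
  constructor
  · rintro rfl
    by_cases h : ∃! z : M, Y (Sum.elim v fun _ => z)
    · obtain ⟨z, hz, hu⟩ := h
      rw [uniqueOrZero_eq hz hu]
      exact Or.inl ⟨hz, fun z' hz' => hu _ hz'⟩
    · refine Or.inr ⟨fun ⟨y, hy, hu⟩ => h ⟨y (), hy, fun z' hz' => hu _ hz'⟩, ?_⟩
      rw [uniqueOrZero, dif_neg h]
  · rintro (⟨hz, hu⟩ | ⟨h, rfl⟩)
    · exact uniqueOrZero_eq hz fun z' hz' => hu (fun _ => z') hz'
    · rw [uniqueOrZero, dif_neg]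
      rintro ⟨z, hz, hu⟩
      exact h ⟨fun _ => z, hz, fun z' hz' => hu _ hz'⟩

theorem IsDefPred.isDefFun_uniqueOrZero {Y : (κ ⊕ Unit → M) → Prop} (hY : IsDefPred Y) :
    IsDefFun (uniqueOrZero Y) := by
  have hu : IsDefPred fun w : κ ⊕ Unit → M =>
      ∀ z' : Unit → M, Y (Sum.elim (w ∘ Sum.inl) z') → z' () = w (Sum.inr ()) :=
    IsDefPred.forall_tuple (X := fun w : (κ ⊕ Unit) ⊕ Unit → M =>
      Y (w ∘ Sum.map Sum.inl id) → w (Sum.inr ()) = w (Sum.inl (Sum.inr ())))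
      ((hY.comp _).imp ((IsTermFun.var _).isDefPred_eq (IsTermFun.var _))) |> fun h => by
        convert h using 5 with w z'
        · rw [Sum.elim_comp_map]
          rfl
        all_goals rfl
  have h0 : IsDefPred fun w : κ ⊕ Unit → M => w (Sum.inr ()) = 0 :=
    (IsTermFun.var _).isDefPred_eq IsTermFun.zero
  have e : ∀ w : κ ⊕ Unit → M, (Sum.elim (w ∘ Sum.inl) fun _ => w (Sum.inr ())) = w := by
    intro w
    ext (i | i) <;> rfl
  have h1 := hY.and hu
  have h2 := (h1.exists_tuple.comp Sum.inl).not.and h0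
  unfold IsDefFun
  simp only [uniqueOrZero_eq_iff, e]
  refine h1.or ?_
  simp only [Sum.elim_comp_inl] at h2
  exact h2

namespace IsDefFun

theorem comp {f : (ι → M) → M} (hf : IsDefFun f) (e : ι → κ) :
    IsDefFun fun v : κ → M => f (v ∘ e) :=
  IsDefPred.comp hf (Sum.map e id)

end IsDefFun

end Definability

section DefinableSequences

open Filter

attribute [local instance] lamStructure

variable {M : Type} [Field M] {ι κ : Type} {N : ℕ} {a : ℕ → Fin N → M}

theorem IsDefFun.comp_defFun [Finite ι] {f : (ι → M) → M} (hf : IsDefFun f)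
    {h : ι → (κ → M) → M} (hh : ∀ i, IsDefFun (h i)) :
    IsDefFun fun v : κ → M => f fun i => h i v := by
  refine IsDefPred.comp_defFun (κ := κ ⊕ Unit) (X := fun w : ι ⊕ Unit → M =>
    f (w ∘ Sum.inl) = w (Sum.inr ())) hf
    (h := Sum.elim (fun i w => h i (w ∘ Sum.inl)) fun u w => w (Sum.inr u)) ?_
  rintro (i | u)
  · exact (hh i).comp Sum.inl
  · exact (IsTermFun.var _).isDefFun

/-- The tuple `(a_n, a_{<l})`. -/
def initTuple (a : ℕ → Fin N → M) (l n : ℕ) : Fin N ⊕ Fin l × Fin N → M :=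
  Sum.elim (a n) fun q => a q.1 q.2

/-- `s_n` is given by a `0`-definable function evaluated at `(a_n, a_{<l})`, uniformly in
`n ≥ l`. -/
def IsDefSeqFrom (a : ℕ → Fin N → M) (l : ℕ) (s : ℕ → M) : Prop :=
  ∃ h : (Fin N ⊕ Fin l × Fin N → M) → M, IsDefFun h ∧ ∀ n, l ≤ n → s n = h (initTuple a l n)

/-- `s_n` is given by a `0`-definable function evaluated at `(a_n, a_{<l})`, uniformly in
`n ≥ l`, for some `l`. -/
def IsDefSeq (a : ℕ → Fin N → M) (s : ℕ → M) : Prop :=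
  ∃ l, IsDefSeqFrom a l s

theorem IsDefSeqFrom.mono {l l' : ℕ} (hl : l ≤ l') {s : ℕ → M} (hs : IsDefSeqFrom a l s) :
    IsDefSeqFrom a l' s := by
  obtain ⟨h, hh, hs⟩ := hs
  refine ⟨_, hh.comp (Sum.map id (Prod.map (Fin.castLE hl) id)), fun n hn => ?_⟩
  rw [hs n (hl.trans hn)]
  congr 1
  ext (i | i) <;> rfl

theorem IsDefSeqFrom.const {l m : ℕ} (hm : l ≤ m) {s : ℕ → M} (hs : IsDefSeqFrom a l s) :
    IsDefSeqFrom a (m + 1) fun _ => s m := by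
  obtain ⟨h, hh, hs⟩ := hs
  refine ⟨_, hh.comp (Sum.elim (fun u => Sum.inr (Fin.last m, u))
    fun q => Sum.inr (Fin.castLE (hm.trans m.le_succ) q.1, q.2)), fun n hn => ?_⟩
  exact (hs m hm).trans (congrArg h (by ext (i | i) <;> rfl))

theorem IsDefSeq.congr {s s' : ℕ → M} (hs : IsDefSeq a s) (h : ∀ᶠ n in atTop, s' n = s n) :
    IsDefSeq a s' := by
  obtain ⟨l, hs⟩ := hs
  obtain ⟨m, hm⟩ := eventually_atTop.1 h
  obtain ⟨g, hg, hs⟩ := hs.mono (le_max_left l m)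
  exact ⟨_, g, hg, fun n hn => by rw [hm n ((le_max_right _ _).trans hn), hs n hn]⟩

theorem exists_isDefSeqFrom [Finite ι] {s : ι → ℕ → M} (hs : ∀ i, IsDefSeq a (s i)) :
    ∃ l, ∀ i, IsDefSeqFrom a l (s i) := by
  choose l hl using hs
  obtain ⟨m, hm⟩ := (Set.finite_range l).bddAbove
  exact ⟨m, fun i => (hl i).mono (hm ⟨i, rfl⟩)⟩

theorem IsDefSeq.coord (i : Fin N) : IsDefSeq a fun n => a n i :=
  ⟨0, _, (IsTermFun.var (Sum.inl i)).isDefFun, fun _ _ => rfl⟩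

theorem IsDefSeq.comp_defFun [Finite ι] {s : ι → ℕ → M} (hs : ∀ i, IsDefSeq a (s i))
    {f : (ι → M) → M} (hf : IsDefFun f) : IsDefSeq a fun n => f fun i => s i n := by
  obtain ⟨l, hl⟩ := exists_isDefSeqFrom hs
  choose h hh hs using hl
  refine ⟨l, _, hf.comp_defFun hh, fun n hn => ?_⟩
  exact congrArg f (funext fun i => hs i n hn)

theorem IsDefSeq.of_unique [Finite ι] {s : ι → ℕ → M} (hs : ∀ i, IsDefSeq a (s i))
    {X : (ι ⊕ Unit → M) → Prop} (hX : IsDefPred X) {y : ℕ → M}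
    (hy : ∀ᶠ n in atTop, X (Sum.elim (fun i => s i n) fun _ => y n))
    (hu : ∀ᶠ n in atTop, ∀ z, X (Sum.elim (fun i => s i n) fun _ => z) → z = y n) :
    IsDefSeq a y := by
  refine (IsDefSeq.comp_defFun hs hX.isDefFun_uniqueOrZero).congr ?_
  filter_upwards [hy, hu] with n hn hu
  exact (uniqueOrZero_eq hn hu).symm

theorem IsDefSeq.eventually_const {s : ℕ → M} (hs : IsDefSeq a s) :
    ∀ᶠ m in atTop, IsDefSeq a fun _ => s m := by
  obtain ⟨l, hl⟩ := hs
  filter_upwards [eventually_ge_atTop l] with m hm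
  exact ⟨_, hl.const hm⟩

theorem isIndiscernible_of_isDefSeqFrom [Finite κ] (ha : LamIndiscernible M a) {l : ℕ}
    {s : κ → ℕ → M} (hs : ∀ k, IsDefSeqFrom a l (s k)) :
    IsIndiscernible (L := lamRingLang) fun n k => s k (l + n) := by
  intro n i j hi hj φ
  choose h hh hs using hs
  have hdef : IsDefPred fun w : Fin (l + n) × Fin N → M =>
      φ.Realize fun q : Fin n × κ => h q.2 (w ∘ Sum.elim (fun u => (Fin.natAdd l q.1, u))
        (Prod.map (Fin.castAdd n) id)) :=
    IsDefPred.comp_defFun ⟨φ, fun _ => Iff.rfl⟩ fun q => (hh q.2).comp _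
  obtain ⟨ψ, hψ⟩ := hdef
  have key : ∀ i : Fin n → ℕ, (φ.Realize fun q : Fin n × κ => s q.2 (l + i q.1)) ↔
      ψ.Realize fun q : Fin (l + n) × Fin N =>
        a ((Fin.append (fun k => (k : ℕ)) fun k => l + i k : Fin (l + n) → ℕ) q.1) q.2 := by
    intro i
    rw [hψ]
    have : (fun q : Fin n × κ => s q.2 (l + i q.1)) = fun q : Fin n × κ =>
        h q.2 ((fun q : Fin (l + n) × Fin N =>
          a ((Fin.append (fun k => (k : ℕ)) fun k => l + i k : Fin (l + n) → ℕ) q.1) q.2) ∘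
          Sum.elim (fun u => (Fin.natAdd l q.1, u)) (Prod.map (Fin.castAdd n) id)) := by
      funext q
      rw [hs q.2 _ (Nat.le_add_right _ _)]
      congr 1
      ext (u | u) <;> simp [initTuple]
    rw [this]
  have mono : ∀ i : Fin n → ℕ, StrictMono i →
      StrictMono (Fin.append (fun k => (k : ℕ)) fun k => l + i k : Fin (l + n) → ℕ) := by
    intro i hi x y
    induction x using Fin.addCases <;> induction y using Fin.addCases <;> intro hxy <;>
      simp only [Fin.append_left, Fin.append_right]
    · exact hxy
    · omega
    · have := Fin.lt_def.1 hxy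
      simp only [Fin.val_natAdd, Fin.val_castAdd] at this
      omega
    · have := Fin.lt_def.1 hxy
      simp only [Fin.val_natAdd] at this
      exact Nat.add_lt_add_left (hi (Fin.lt_def.2 (by omega))) _
  rw [key, key]
  exact ha _ _ _ (mono i hi) (mono j hj) ψ

theorem IsDefPred.eventually_or_eventually_not [Finite ι] (ha : LamIndiscernible M a)
    {s : ι → ℕ → M} (hs : ∀ i, IsDefSeq a (s i)) {X : (ι → M) → Prop} (hX : IsDefPred X) :
    (∀ᶠ n in atTop, X fun i => s i n) ∨ ∀ᶠ n in atTop, ¬X fun i => s i n := by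
  obtain ⟨l, hl⟩ := exists_isDefSeqFrom hs
  obtain ⟨φ, hφ⟩ := hX
  have key : ∀ n, l ≤ n → ((X fun i => s i n) ↔ X fun i => s i l) := by
    intro n hn
    have := isIndiscernible_of_isDefSeqFrom ha hl 1 (fun _ => n - l) (fun _ => 0)
      (Subsingleton.strictMono _) (Subsingleton.strictMono _) (φ.relabel fun i => (0, i))
    simpa [Formula.realize_relabel, hφ, Function.comp_def, Nat.add_sub_cancel' hn] using this
  by_cases h : X fun i => s i l
  · left
    filter_upwards [eventually_ge_atTop l] with n hn using (key n hn).2 h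
  · right
    filter_upwards [eventually_ge_atTop l] with n hn using fun h' => h ((key n hn).1 h')

end DefinableSequences

section FrobeniusIndependence

variable {M : Type*} [Field M] {ι : Type*} [Fintype ι]

theorem expChar_pexp (M : Type*) [Field M] : ExpChar M (pexp M) := by
  rcases CharP.char_is_prime_or_zero M (ringChar M) with h | h
  · have : pexp M = ringChar M := max_eq_left h.one_le
    rw [this]
    exact ExpChar.prime h
  · have : CharZero M := (CharP.ringChar_zero_iff_CharZero M).1 h
    have : pexp M = 1 := by rw [pexp, h]; rfl
    rw [this]
    exact ExpChar.zero

/-- The family `v` is linearly independent over the subfield of `p`-th powers. -/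
def PIndep (p : ℕ) (v : ι → M) : Prop :=
  ∀ c : ι → M, ∑ i, c i ^ p * v i = 0 → ∀ i, c i = 0

variable (p : ℕ) [ExpChar M p]

theorem pIndep_iff_linearIndependent (v : ι → M) :
    PIndep p v ↔ LinearIndependent (frobenius M p).fieldRange v := by
  rw [Fintype.linearIndependent_iff]
  constructor
  · intro h g hg i
    choose c hc using fun i => (g i).2
    have hc' : ∀ i, c i ^ p = g i := hc
    have := h c (by simpa only [hc', Subfield.smul_def, smul_eq_mul] using hg) i
    ext
    rw [← hc', this, zero_pow (expChar_ne_zero M p)]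
    rfl
  · intro h c hc i
    have := h (fun i => ⟨c i ^ p, c i, rfl⟩)
      (by simpa only [Subfield.smul_def, smul_eq_mul] using hc) i
    exact eq_zero_of_pow_eq_zero (congrArg Subtype.val this)

theorem mem_span_fieldRange_frobenius_iff (v : ι → M) (y : M) :
    y ∈ Submodule.span (frobenius M p).fieldRange (Set.range v) ↔
      ∃ c : ι → M, y = ∑ i, c i ^ p * v i := by
  rw [Submodule.mem_span_range_iff_exists_fun]
  constructor
  · rintro ⟨g, rfl⟩
    choose c hc using fun i => (g i).2
    have hc' : ∀ i, c i ^ p = g i := hc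
    exact ⟨c, by simp only [hc', Subfield.smul_def, smul_eq_mul]⟩
  · rintro ⟨c, rfl⟩
    exact ⟨fun i => ⟨c i ^ p, c i, rfl⟩, by simp only [Subfield.smul_def, smul_eq_mul]⟩

theorem PIndep.injective {p : ℕ} [ExpChar M p] {v : ι → M} (hv : PIndep p v) {c c' : ι → M}
    (h : ∑ i, c i ^ p * v i = ∑ i, c' i ^ p * v i) : c = c' := by
  have := hv (c - c') (by
    simp only [Pi.sub_apply, sub_pow_expChar, sub_mul, Finset.sum_sub_distrib, h, sub_self])
  exact funext fun i => sub_eq_zero.1 (this i)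

theorem sum_pow_expChar_eq {β : Type*} (s : Finset β) (f : β → M) :
    (∑ b ∈ s, f b) ^ p = ∑ b ∈ s, f b ^ p :=
  map_sum (frobenius M p) f s

end FrobeniusIndependence

section DefinableSequenceAlgebra

open Filter

variable {M : Type} [Field M] {ι : Type} {N : ℕ} {a : ℕ → Fin N → M}

theorem isDefPred_pIndep [Fintype ι] (p : ℕ) : IsDefPred fun v : ι → M => PIndep p v := by
  refine IsDefPred.forall_tuple (X := fun w : ι ⊕ ι → M =>
    ∑ i, w (Sum.inr i) ^ p * w (Sum.inl i) = 0 → ∀ i, w (Sum.inr i) = 0) ?_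
  exact ((IsTermFun.sum _ fun i => ((IsTermFun.var _).pow p).mul (IsTermFun.var _)).isDefPred_eq
    IsTermFun.zero).imp
    (IsDefPred.forall_finite fun i => (IsTermFun.var _).isDefPred_eq IsTermFun.zero)

theorem IsDefSeq.of_eq_sum_pow [Fintype ι] {p : ℕ} [ExpChar M p] {e : ι → ℕ → M} {y : ℕ → M}
    (he : ∀ i, IsDefSeq a (e i)) (hy : IsDefSeq a y)
    (hind : ∀ᶠ n in atTop, PIndep p fun i => e i n) {q : ι → ℕ → M}
    (hq : ∀ᶠ n in atTop, y n = ∑ i, q i n ^ p * e i n) (i : ι) : IsDefSeq a (q i) := by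
  refine IsDefSeq.of_unique (ι := Option ι) (s := fun o => o.elim y e)
    (Option.rec hy he) (X := fun w : Option ι ⊕ Unit → M => ∃ c : ι → M,
      w (Sum.inl none) = ∑ i, c i ^ p * w (Sum.inl (some i)) ∧ c i = w (Sum.inr ())) ?_ ?_ ?_
  · refine IsDefPred.exists_tuple (X := fun w : (Option ι ⊕ Unit) ⊕ ι → M =>
      w (Sum.inl (Sum.inl none)) = ∑ i, w (Sum.inr i) ^ p * w (Sum.inl (Sum.inl (some i))) ∧
        w (Sum.inr i) = w (Sum.inl (Sum.inr ()))) ?_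
    exact ((IsTermFun.var _).isDefPred_eq
      (IsTermFun.sum _ fun i => ((IsTermFun.var _).pow p).mul (IsTermFun.var _))).and
      ((IsTermFun.var _).isDefPred_eq (IsTermFun.var _))
  · filter_upwards [hq] with n hn
    exact ⟨fun i => q i n, hn, rfl⟩
  · filter_upwards [hq, hind] with n hn hi
    rintro z ⟨c, hc, rfl⟩
    exact congrFun (hi.injective (hc.symm.trans hn)) i

/-- The ring of definable sequences. -/
def defSeqSubring (a : ℕ → Fin N → M) : Subring (ℕ → M) where
  carrier := {s | IsDefSeq a s}
  zero_mem' := IsDefSeq.comp_defFun (ι := Empty) (s := fun i => i.elim) (fun i => i.elim)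
    IsTermFun.zero.isDefFun
  one_mem' := IsDefSeq.comp_defFun (ι := Empty) (s := fun i => i.elim) (fun i => i.elim)
    IsTermFun.one.isDefFun
  add_mem' {s t} hs ht := IsDefSeq.comp_defFun (s := ![s, t])
    (by simpa [Fin.forall_fin_two] using ⟨hs, ht⟩)
    ((IsTermFun.var 0).add (IsTermFun.var 1)).isDefFun
  mul_mem' {s t} hs ht := IsDefSeq.comp_defFun (s := ![s, t])
    (by simpa [Fin.forall_fin_two] using ⟨hs, ht⟩)
    ((IsTermFun.var 0).mul (IsTermFun.var 1)).isDefFun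
  neg_mem' {s} hs := IsDefSeq.comp_defFun (ι := Unit) (s := fun _ => s) (fun _ => hs)
    (IsTermFun.var ()).neg.isDefFun

theorem IsDefSeq.mul {s t : ℕ → M} (hs : IsDefSeq a s) (ht : IsDefSeq a t) :
    IsDefSeq a fun n => s n * t n :=
  (defSeqSubring a).mul_mem hs ht

theorem IsDefSeq.sum {β : Type*} (S : Finset β) {s : β → ℕ → M} (hs : ∀ b, IsDefSeq a (s b)) :
    IsDefSeq a fun n => ∑ b ∈ S, s b n := by
  have : ∑ b ∈ S, s b ∈ defSeqSubring a := (defSeqSubring a).sum_mem fun b _ => hs b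
  rwa [funext fun n => (Finset.sum_apply n S s).symm]

theorem IsDefSeq.inv {s : ℕ → M} (hs : IsDefSeq a s) : IsDefSeq a fun n => (s n)⁻¹ := by
  refine IsDefSeq.of_unique (ι := Unit) (fun _ => hs) (X := fun w =>
    w (Sum.inl ()) * w (Sum.inr ()) = 1 ∨ w (Sum.inl ()) = 0 ∧ w (Sum.inr ()) = 0) ?_ ?_ ?_
  · exact (((IsTermFun.var _).mul (IsTermFun.var _)).isDefPred_eq IsTermFun.one).or
      (((IsTermFun.var _).isDefPred_eq IsTermFun.zero).and
        ((IsTermFun.var _).isDefPred_eq IsTermFun.zero))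
  · refine Eventually.of_forall fun n => ?_
    by_cases h : s n = 0 <;> simp [h]
  · refine Eventually.of_forall fun n z hz => ?_
    rcases hz with hz | ⟨h, hz⟩
    · exact eq_inv_of_mul_eq_one_right hz
    · simp only [Sum.elim_inl, Sum.elim_inr] at h hz
      rw [h, hz, inv_zero]

/-- The field of elements whose constant sequence is definable. -/
def defConst (a : ℕ → Fin N → M) : Subfield M where
  carrier := {x | IsDefSeq a fun _ => x}
  zero_mem' := (defSeqSubring a).zero_mem
  one_mem' := (defSeqSubring a).one_mem
  add_mem' hx hy := (defSeqSubring a).add_mem hx hy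
  mul_mem' hx hy := (defSeqSubring a).mul_mem hx hy
  neg_mem' hx := (defSeqSubring a).neg_mem hx
  inv_mem' _ hx := IsDefSeq.inv hx

theorem exists_eventually_pIndep_basis [Fintype ι] (ha : LamIndiscernible M a)
    (p : ℕ) [ExpChar M p] {x : ι → ℕ → M} (hx : ∀ i, IsDefSeq a (x i)) :
    ∃ (J : Finset ι) (q : ι → J → ℕ → M), (∀ i j, IsDefSeq a (q i j)) ∧
      (∀ᶠ n in atTop, PIndep p fun j : J => x j n) ∧
      ∀ᶠ n in atTop, ∀ i, x i n = ∑ j : J, q i j n ^ p * x j n := by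
  classical
  let good : Finset ι → Prop := fun J => ∀ᶠ n in atTop, PIndep p fun j : J => x j n
  obtain ⟨J, hJ⟩ := (Set.toFinite {J | good J}).exists_maximal
    ⟨∅, Eventually.of_forall fun n c _ i => absurd i.2 (Finset.notMem_empty _)⟩
  have hind : ∀ᶠ n in atTop, PIndep p fun j : J => x j n := hJ.prop
  have hspan : ∀ i, ∀ᶠ n in atTop, ∃ c : J → M, x i n = ∑ j : J, c j ^ p * x j n := by
    intro i
    by_cases hi : i ∈ J
    · refine Eventually.of_forall fun n => ⟨Pi.single ⟨i, hi⟩ 1, ?_⟩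
      rw [Finset.sum_eq_single ⟨i, hi⟩]
      · simp
      · intro j _ hj
        simp [hj, zero_pow (expChar_ne_zero M p)]
      · simp
    · have hbad : ¬good (insert i J) := fun h =>
        hi (hJ.le_of_ge h (Finset.subset_insert i J) (Finset.mem_insert_self i J))
      have := (IsDefPred.eventually_or_eventually_not ha
        (fun j : (insert i J : Finset ι) => hx j) (isDefPred_pIndep p)).resolve_left hbad
      filter_upwards [this, hind] with n hn hJn
      rw [pIndep_iff_linearIndependent] at hn hJn
      rw [← mem_span_fieldRange_frobenius_iff]
      by_contra hmem
      apply hn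
      have h1 : LinearIndepOn (frobenius M p).fieldRange (fun i => x i n) (J : Set ι) := hJn
      have h2 := h1.insert (x := i) (by rwa [Set.image_eq_range])
      have h3 : LinearIndepOn (frobenius M p).fieldRange (fun i => x i n)
        ((insert i J : Finset ι) : Set ι) := by rwa [Finset.coe_insert]
      exact h3
  have hspan' : ∀ i, ∃ q : J → ℕ → M,
      ∀ᶠ n in atTop, x i n = ∑ j : J, q j n ^ p * x j n := by
    intro i
    obtain ⟨m, hm⟩ := eventually_atTop.1 (hspan i)
    choose c hc using hm
    refine ⟨fun j n => if h : m ≤ n then c n h j else 0, ?_⟩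
    filter_upwards [eventually_ge_atTop m] with n hn
    simpa only [dif_pos hn] using hc n hn
  choose q hq using hspan'
  exact ⟨J, q, fun i j => IsDefSeq.of_eq_sum_pow (fun j : J => hx j) (hx i) hind (hq i) j, hind,
    eventually_all.2 hq⟩

end DefinableSequenceAlgebra

section Combinations

open Filter

variable {M : Type} [Field M] {ι : Type} {N : ℕ} {a : ℕ → Fin N → M}

/-- `σ` is a linear combination of definable sequences with constant coefficients. -/
def IsCombSeq (a : ℕ → Fin N → M) (σ : ℕ → M) : Prop :=
  ∃ (k : ℕ) (s : Fin k → ℕ → M) (d : Fin k → M), (∀ i, IsDefSeq a (s i)) ∧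
    ∀ n, σ n = ∑ i, s i n * d i

theorem IsCombSeq.of_sum [Fintype ι] {σ : ℕ → M} {s : ι → ℕ → M} {d : ι → M}
    (hs : ∀ i, IsDefSeq a (s i)) (h : ∀ n, σ n = ∑ i, s i n * d i) : IsCombSeq a σ := by
  let e := Fintype.equivFin ι
  refine ⟨_, fun i => s (e.symm i), fun i => d (e.symm i), fun i => hs _, fun n => ?_⟩
  rw [h, ← e.symm.sum_comp]

/-- The ring of linear combinations of definable sequences with constant coefficients. -/
def combSubring (a : ℕ → Fin N → M) : Subring (ℕ → M) where
  carrier := {σ | IsCombSeq a σ}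
  zero_mem' := ⟨0, 0, 0, fun i => i.elim0, fun n => by simp⟩
  one_mem' := IsCombSeq.of_sum (ι := Unit) (s := fun _ => 1) (d := fun _ => 1)
    (fun _ => (defSeqSubring a).one_mem) fun n => by simp
  add_mem' := by
    rintro σ τ ⟨k, s, d, hs, hσ⟩ ⟨k', s', d', hs', hτ⟩
    refine IsCombSeq.of_sum (ι := Fin k ⊕ Fin k') (s := Sum.elim s s') (d := Sum.elim d d')
      (Sum.rec hs hs') fun n => ?_
    simp [hσ, hτ]
  mul_mem' := by
    rintro σ τ ⟨k, s, d, hs, hσ⟩ ⟨k', s', d', hs', hτ⟩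
    refine IsCombSeq.of_sum (ι := Fin k × Fin k') (s := fun i n => s i.1 n * s' i.2 n)
      (d := fun i => d i.1 * d' i.2) (fun i => (hs _).mul (hs' _)) fun n => ?_
    simp only [Pi.mul_apply, hσ, hτ, Finset.sum_mul_sum, Fintype.sum_prod_type]
    exact Finset.sum_congr rfl fun i _ => Finset.sum_congr rfl fun j _ => by ring
  neg_mem' := by
    rintro σ ⟨k, s, d, hs, hσ⟩
    exact ⟨k, s, -d, hs, fun n => by simp [hσ]⟩

theorem IsDefSeq.isCombSeq_mul_const {s : ℕ → M} (hs : IsDefSeq a s) (d : M) :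
    IsCombSeq a fun n => s n * d :=
  IsCombSeq.of_sum (ι := Unit) (s := fun _ => s) (d := fun _ => d) (fun _ => hs)
    fun n => by simp

theorem IsDefSeq.isCombSeq {s : ℕ → M} (hs : IsDefSeq a s) : IsCombSeq a s := by
  simpa using hs.isCombSeq_mul_const 1

theorem isCombSeq_const (d : M) : IsCombSeq a fun _ => d :=
  IsCombSeq.of_sum (ι := Unit) (s := fun _ => 1) (d := fun _ => d)
    (fun _ => (defSeqSubring a).one_mem) fun n => by simp

theorem IsCombSeq.sum {β : Type*} (S : Finset β) {s : β → ℕ → M}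
    (hs : ∀ b, IsCombSeq a (s b)) : IsCombSeq a fun n => ∑ b ∈ S, s b n := by
  have : ∑ b ∈ S, s b ∈ combSubring a := (combSubring a).sum_mem fun b _ => hs b
  rwa [funext fun n => (Finset.sum_apply n S s).symm]

theorem IsCombSeq.eventually_eq_zero_or_ne_zero (ha : LamIndiscernible M a) {σ : ℕ → M}
    (hσ : IsCombSeq a σ) : (∀ᶠ n in atTop, σ n = 0) ∨ ∀ᶠ n in atTop, σ n ≠ 0 := by
  obtain ⟨k, s, d, hs, hσ⟩ := hσ
  obtain ⟨κ, e, he, hspan, hind⟩ := exists_linearIndependent' (defConst a) d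
  have : Fintype κ := Fintype.ofInjective e he
  have hc : ∀ i, ∃ c : κ → defConst a, ∑ j, c j • d (e j) = d i := fun i =>
    (Submodule.mem_span_range_iff_exists_fun (defConst a)).1
      (hspan ▸ Submodule.subset_span ⟨i, rfl⟩)
  choose c hc using hc
  let u : κ → ℕ → M := fun j n => ∑ i, s i n * c i j
  have hu : ∀ j, IsDefSeq a (u j) := fun j =>
    IsDefSeq.sum _ fun i => (hs i).mul (c i j).2
  have hσu : ∀ n, σ n = ∑ j, u j n * d (e j) := by
    intro n
    simp only [hσ, u, Finset.sum_mul]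
    rw [Finset.sum_comm]
    refine Finset.sum_congr rfl fun i _ => ?_
    rw [← hc, Finset.mul_sum]
    exact Finset.sum_congr rfl fun j _ => by rw [Subfield.smul_def, smul_eq_mul, mul_assoc]
  have hX : IsDefPred fun w : κ → M => ∀ j, w j = 0 :=
    IsDefPred.forall_finite fun j => (IsTermFun.var _).isDefPred_eq IsTermFun.zero
  have hconst : ∀ᶠ n in atTop, ∀ j, IsDefSeq a fun _ => u j n :=
    eventually_all.2 fun j => (hu j).eventually_const
  refine (IsDefPred.eventually_or_eventually_not ha hu hX).imp (fun h => ?_) fun h => ?_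
  · filter_upwards [h] with n hn
    simp [hσu, hn]
  · filter_upwards [h, hconst] with n hn hC h0
    refine hn fun j => ?_
    have := Fintype.linearIndependent_iff.1 hind (fun j => ⟨u j n, hC j⟩)
      (by rw [← h0, hσu]; rfl) j
    exact congrArg Subtype.val this

theorem exists_finite_sum_of_mem_adjoin {F : Type*} [Field F] [Algebra F M] (C : Subring M)
    (hC : ∀ x ∈ C, IsAlgebraic F x) {x : M} (hx : x ∈ IntermediateField.adjoin F (C : Set M)) :
    ∃ (k : ℕ) (f : Fin k → F) (g : Fin k → C), ∑ i, f i • (g i : M) = x := by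
  rw [← IntermediateField.mem_toSubalgebra,
    IntermediateField.adjoin_toSubalgebra_of_isAlgebraic hC, ← Subalgebra.mem_toSubmodule,
    Algebra.adjoin_eq_span] at hx
  have : (Submonoid.closure (C : Set M) : Set M) = C :=
    congrArg SetLike.coe (Submonoid.closure_eq C.toSubmonoid)
  rw [this] at hx
  exact Submodule.mem_span_set'.1 hx

theorem linearIndependent_mul_of_mem {F β γ : Type*} [Field F] [Algebra F M]
    {K : IntermediateField F M} {x : β → M} (hx : LinearIndependent F x) (hxK : ∀ b, x b ∈ K)
    {y : γ → M} (hy : LinearIndependent K y) :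
    LinearIndependent F fun i : β × γ => x i.1 * y i.2 :=
  linearIndependent_smul (R := F) (S := K) (b := fun b => (⟨x b, hxK b⟩ : K))
    (LinearIndependent.of_comp K.val.toLinearMap hx) hy

theorem exists_pIndep_expansion [Fintype ι] (ha : LamIndiscernible M a) (p : ℕ) [ExpChar M p]
    {s : ι → ℕ → M} (hs : ∀ i, IsDefSeq a (s i)) (w : ι → M) :
    ∃ (B : Type) (_ : Fintype B) (e : B → ℕ → M) (q : ι → B → ℕ → M),
      (∀ i b, IsCombSeq a (q i b)) ∧ (∀ᶠ n in atTop, PIndep p fun b => e b n) ∧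
      ∀ᶠ n in atTop, ∀ i, s i n * w i = ∑ b, q i b n ^ p * e b n := by
  let F := (frobenius M p).fieldRange
  let K := IntermediateField.adjoin F (defConst a : Set M)
  obtain ⟨H, o, ho, hspan, hind⟩ := exists_linearIndependent' K w
  have : Fintype H := Fintype.ofInjective o ho
  have hk : ∀ i, ∃ c : H → K, ∑ h, c h • w (o h) = w i := fun i =>
    (Submodule.mem_span_range_iff_exists_fun K).1 (hspan ▸ Submodule.subset_span ⟨i, rfl⟩)
  choose c hc using hk
  have halg : ∀ x ∈ (defConst a).toSubring, IsAlgebraic F x := fun x _ => by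
    refine IsIntegral.isAlgebraic (IsIntegral.of_pow (expChar_pos M p) ?_)
    exact isIntegral_algebraMap (x := (⟨x ^ p, x, rfl⟩ : F))
  have hf := fun i h => exists_finite_sum_of_mem_adjoin (defConst a).toSubring halg (c i h).2
  choose m f g hfg using hf
  choose f' hf' using fun i h u => (f i h u).2
  have hf'' : ∀ i h u, f' i h u ^ p = f i h u := hf'
  obtain ⟨J, q, hq, hJ, hexp⟩ := exists_eventually_pIndep_basis ha p
    (x := fun (γ : Σ (i : ι) (h : H), Fin (m i h)) n => (g γ.1 γ.2.1 γ.2.2 : M) * s γ.1 n)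
    fun γ => IsDefSeq.mul (g γ.1 γ.2.1 γ.2.2).2 (hs γ.1)
  set x : (Σ (i : ι) (h : H), Fin (m i h)) → ℕ → M :=
    fun γ n => (g γ.1 γ.2.1 γ.2.2 : M) * s γ.1 n with hx
  have hconst : ∀ᶠ n in atTop, ∀ j : J, IsDefSeq a fun _ => x j n :=
    eventually_all.2 fun j =>
      (IsDefSeq.mul (g j.1.1 j.1.2.1 j.1.2.2).2 (hs j.1.1)).eventually_const
  refine ⟨J × H, inferInstance, fun b n => x b.1 n * w (o b.2),
    fun i b n => ∑ u, f' i b.2 u * q ⟨i, b.2, u⟩ b.1 n, fun i b => ?_, ?_, ?_⟩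
  · exact IsCombSeq.sum _ fun u => by
      simpa only [mul_comm] using (hq ⟨i, b.2, u⟩ b.1).isCombSeq_mul_const (f' i b.2 u)
  · filter_upwards [hJ, hconst] with n hn hC
    rw [pIndep_iff_linearIndependent] at hn ⊢
    have hxK : ∀ j : J, x j n ∈ K := fun j => IntermediateField.subset_adjoin F _ (hC j)
    have hmul := linearIndependent_mul_of_mem hn hxK hind
    exact hmul
  · filter_upwards [hexp] with n hn i
    have h1 : s i n * w i = ∑ h, ∑ u, f' i h u ^ p * x ⟨i, h, u⟩ n * w (o h) := by
      conv_lhs => rw [← hc, Finset.mul_sum]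
      refine Finset.sum_congr rfl fun h _ => ?_
      rw [IntermediateField.smul_def, ← hfg, smul_eq_mul, Finset.sum_mul, Finset.mul_sum]
      refine Finset.sum_congr rfl fun u _ => ?_
      rw [hf'', Subfield.smul_def, smul_eq_mul, hx]
      ring
    rw [h1, Fintype.sum_prod_type, Finset.sum_comm]
    refine Finset.sum_congr rfl fun h _ => ?_
    have hn' : ∀ γ, x γ n = ∑ j, q γ j n ^ p * x j n := hn
    simp only [hn' ⟨i, h, _⟩, sum_pow_expChar_eq, mul_pow, Finset.sum_mul, Finset.mul_sum]
    rw [Finset.sum_comm]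
    exact Finset.sum_congr rfl fun j _ => Finset.sum_congr rfl fun u _ => by ring

theorem IsCombSeq.exists_pIndep_expansion [Fintype ι] (ha : LamIndiscernible M a) (p : ℕ)
    [ExpChar M p] {σ : ι → ℕ → M} (hσ : ∀ i, IsCombSeq a (σ i)) :
    ∃ (B : Type) (_ : Fintype B) (e : B → ℕ → M) (q : ι → B → ℕ → M),
      (∀ i b, IsCombSeq a (q i b)) ∧ (∀ᶠ n in atTop, PIndep p fun b => e b n) ∧
      ∀ᶠ n in atTop, ∀ i, σ i n = ∑ b, q i b n ^ p * e b n := by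
  choose k s d hs hσ using hσ
  obtain ⟨B, hB, e, q, hq, he, hexp⟩ := NIPPaper.exists_pIndep_expansion ha p
    (s := fun (t : Σ i, Fin (k i)) => s t.1 t.2) (fun t => hs t.1 t.2) fun t => d t.1 t.2
  refine ⟨B, hB, e, fun i b n => ∑ j, q ⟨i, j⟩ b n, fun i b => IsCombSeq.sum _ fun j => hq _ _,
    he, ?_⟩
  filter_upwards [hexp] with n hn i
  have h1 : σ i n = ∑ j, ∑ b, q ⟨i, j⟩ b n ^ p * e b n :=
    (hσ i n).trans (Finset.sum_congr rfl fun j _ => hn ⟨i, j⟩)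
  rw [h1, Finset.sum_comm]
  exact Finset.sum_congr rfl fun b _ => by rw [sum_pow_expChar_eq, Finset.sum_mul]

end Combinations

section Fractions

open Filter

variable {M : Type} [Field M] {ι : Type} {N : ℕ} {a : ℕ → Fin N → M}

/-- `τ` eventually agrees with a quotient of linear combinations of definable sequences, with
eventually nonvanishing denominator. -/
def IsFracSeq (a : ℕ → Fin N → M) (τ : ℕ → M) : Prop :=
  ∃ σ ρ : ℕ → M, IsCombSeq a σ ∧ IsCombSeq a ρ ∧ (∀ᶠ n in atTop, ρ n ≠ 0) ∧
    ∀ᶠ n in atTop, τ n = σ n / ρ n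

theorem IsCombSeq.isFracSeq {σ : ℕ → M} (hσ : IsCombSeq a σ) : IsFracSeq a σ :=
  ⟨σ, 1, hσ, (combSubring a).one_mem, Eventually.of_forall fun _ => one_ne_zero,
    Eventually.of_forall fun _ => by simp⟩

theorem IsFracSeq.congr {τ τ' : ℕ → M} (hτ : IsFracSeq a τ)
    (h : ∀ᶠ n in atTop, τ' n = τ n) : IsFracSeq a τ' := by
  obtain ⟨σ, ρ, hσ, hρ, h0, hτ⟩ := hτ
  exact ⟨σ, ρ, hσ, hρ, h0, by filter_upwards [h, hτ] with n h1 h2 using h1.trans h2⟩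

/-- The ring of sequences which are eventually quotients of linear combinations of definable
sequences. -/
def fracSubring (a : ℕ → Fin N → M) : Subring (ℕ → M) where
  carrier := {τ | IsFracSeq a τ}
  zero_mem' := IsCombSeq.isFracSeq (combSubring a).zero_mem
  one_mem' := IsCombSeq.isFracSeq (combSubring a).one_mem
  add_mem' := by
    rintro τ τ' ⟨σ, ρ, hσ, hρ, h0, hτ⟩ ⟨σ', ρ', hσ', hρ', h0', hτ'⟩
    refine ⟨σ * ρ' + ρ * σ', ρ * ρ', (combSubring a).add_mem ((combSubring a).mul_mem hσ hρ')
      ((combSubring a).mul_mem hρ hσ'), (combSubring a).mul_mem hρ hρ', ?_, ?_⟩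
    · filter_upwards [h0, h0'] with n h h' using mul_ne_zero h h'
    · filter_upwards [h0, h0', hτ, hτ'] with n h h' e e'
      simp only [Pi.add_apply, Pi.mul_apply, e, e', div_add_div _ _ h h']
  mul_mem' := by
    rintro τ τ' ⟨σ, ρ, hσ, hρ, h0, hτ⟩ ⟨σ', ρ', hσ', hρ', h0', hτ'⟩
    refine ⟨σ * σ', ρ * ρ', (combSubring a).mul_mem hσ hσ', (combSubring a).mul_mem hρ hρ',
      ?_, ?_⟩
    · filter_upwards [h0, h0'] with n h h' using mul_ne_zero h h'
    · filter_upwards [hτ, hτ'] with n e e'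
      simp only [Pi.mul_apply, e, e', div_mul_div_comm]
  neg_mem' := by
    rintro τ ⟨σ, ρ, hσ, hρ, h0, hτ⟩
    refine ⟨-σ, ρ, (combSubring a).neg_mem hσ, hρ, h0, ?_⟩
    filter_upwards [hτ] with n e
    simp only [Pi.neg_apply, e, neg_div]

/-- The ideal of eventually vanishing sequences. -/
def evZeroIdeal (a : ℕ → Fin N → M) : Ideal (fracSubring a) where
  carrier := {τ | ∀ᶠ n in atTop, (τ : ℕ → M) n = 0}
  zero_mem' := Eventually.of_forall fun _ => rfl
  add_mem' := by
    intro σ τ hσ hτ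
    filter_upwards [hσ, hτ] with n h h'
    simp [h, h']
  smul_mem' := by
    intro σ τ hτ
    filter_upwards [hτ] with n h
    simp [h]

theorem mk_evZeroIdeal_eq_iff {σ τ : fracSubring a} :
    Ideal.Quotient.mk (evZeroIdeal a) σ = Ideal.Quotient.mk (evZeroIdeal a) τ ↔
      ∀ᶠ n in atTop, (σ : ℕ → M) n = (τ : ℕ → M) n := by
  rw [Ideal.Quotient.eq]
  exact eventually_congr (Eventually.of_forall fun n => sub_eq_zero)

theorem IsFracSeq.eventually_eq_zero_or_ne_zero (ha : LamIndiscernible M a) {τ : ℕ → M}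
    (hτ : IsFracSeq a τ) : (∀ᶠ n in atTop, τ n = 0) ∨ ∀ᶠ n in atTop, τ n ≠ 0 := by
  obtain ⟨σ, ρ, hσ, hρ, h0, hτ⟩ := hτ
  refine (hσ.eventually_eq_zero_or_ne_zero ha).imp (fun h => ?_) fun h => ?_
  · filter_upwards [h, hτ] with n hn e
    rw [e, hn, zero_div]
  · filter_upwards [h, h0, hτ] with n hn h0 e
    rw [e]
    exact div_ne_zero hn h0

theorem IsFracSeq.inv (ha : LamIndiscernible M a) {τ : ℕ → M} (hτ : IsFracSeq a τ) :
    IsFracSeq a fun n => (τ n)⁻¹ := by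
  obtain ⟨σ, ρ, hσ, hρ, h0, hτ⟩ := hτ
  rcases hσ.eventually_eq_zero_or_ne_zero ha with h | h
  · refine IsFracSeq.congr (fracSubring a).zero_mem ?_
    filter_upwards [h, hτ] with n hn e
    simp [e, hn]
  · refine ⟨ρ, σ, hρ, hσ, h, ?_⟩
    filter_upwards [hτ] with n e
    rw [e, inv_div]

theorem isMaximal_evZeroIdeal (ha : LamIndiscernible M a) : (evZeroIdeal a).IsMaximal := by
  refine Ideal.isMaximal_iff.2 ⟨fun h => ?_, fun J x hIJ hx hxJ => ?_⟩
  · obtain ⟨n, hn⟩ := Eventually.exists (show ∀ᶠ n : ℕ in atTop, (1 : M) = 0 from h)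
    exact one_ne_zero hn
  · have h0 := (IsFracSeq.eventually_eq_zero_or_ne_zero ha x.2).resolve_left hx
    let y : fracSubring a := ⟨_, IsFracSeq.inv ha x.2⟩
    have h1 : y * x - 1 ∈ evZeroIdeal a := by
      change ∀ᶠ n in atTop, _
      filter_upwards [h0] with n hn
      exact sub_eq_zero.2 (inv_mul_cancel₀ hn)
    simpa using J.sub_mem (J.mul_mem_left y hxJ) (hIJ h1)

theorem eventually_linearIndependent [Fintype ι] {B : Type} [Fintype B]
    (ha : LamIndiscernible M a) (q : ι → B → fracSubring a)
    (hq : letI := isMaximal_evZeroIdeal ha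
      letI := Ideal.Quotient.field (evZeroIdeal a)
      LinearIndependent (fracSubring a ⧸ evZeroIdeal a)
        fun i b => Ideal.Quotient.mk (evZeroIdeal a) (q i b)) :
    ∀ᶠ n in atTop, LinearIndependent M fun i b => (q i b : ℕ → M) n := by
  classical
  have := isMaximal_evZeroIdeal ha
  let := Ideal.Quotient.field (evZeroIdeal a)
  obtain ⟨g, hg⟩ := LinearMap.exists_leftInverse_of_injective
    (Fintype.linearCombination (fracSubring a ⧸ evZeroIdeal a)
      fun i b => Ideal.Quotient.mk (evZeroIdeal a) (q i b))
    (LinearMap.ker_eq_bot.2 (linearIndependent_iff_injective_fintypeLinearCombination.1 hq))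
  choose X hX using fun (b : B) (i : ι) => Ideal.Quotient.mk_surjective
    (I := evZeroIdeal a) (g (fun j => if b = j then 1 else 0) i)
  have key : ∀ i i', Ideal.Quotient.mk (evZeroIdeal a) (∑ b, q i b * X b i') =
      Ideal.Quotient.mk (evZeroIdeal a) (if i' = i then 1 else 0) := by
    intro i i'
    have h1 := congrFun (LinearMap.congr_fun hg (Pi.single i 1)) i'
    rw [LinearMap.comp_apply, Fintype.linearCombination_apply_single, one_smul,
      LinearMap.pi_apply_eq_sum_univ g] at h1
    simp only [Finset.sum_apply, Pi.smul_apply, smul_eq_mul, ← hX, LinearMap.id_apply,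
      Pi.single_apply] at h1
    rw [map_sum]
    simp only [map_mul, h1]
    split_ifs <;> simp
  have hev : ∀ᶠ n in atTop, ∀ i i', ∑ b, (q i b : ℕ → M) n * (X b i' : ℕ → M) n =
      if i' = i then 1 else 0 := by
    refine eventually_all.2 fun i => eventually_all.2 fun i' => ?_
    filter_upwards [mk_evZeroIdeal_eq_iff.1 (key i i')] with n hn
    have h2 : ((∑ b, q i b * X b i' : fracSubring a) : ℕ → M) n =
        ∑ b, (q i b : ℕ → M) n * (X b i' : ℕ → M) n := by
      rw [AddSubmonoidClass.coe_finsetSum, Finset.sum_apply]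
      rfl
    rw [← h2, hn]
    split_ifs <;> rfl
  filter_upwards [hev] with n hn
  refine Fintype.linearIndependent_iff.2 fun c hc i' => ?_
  have hcb : ∀ b, ∑ i, c i * (q i b : ℕ → M) n = 0 := fun b => by
    simpa using congrFun hc b
  calc c i' = ∑ i, c i * ∑ b, (q i b : ℕ → M) n * (X b i' : ℕ → M) n := by simp [hn]
    _ = ∑ b, (∑ i, c i * (q i b : ℕ → M) n) * (X b i' : ℕ → M) n := by
      simp only [Finset.mul_sum, Finset.sum_mul, mul_assoc]
      exact Finset.sum_comm
    _ = 0 := by simp [hcb]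

theorem IsFracSeq.exists_pIndep_expansion [Fintype ι] (ha : LamIndiscernible M a) (p : ℕ)
    [ExpChar M p] {τ : ι → ℕ → M} (hτ : ∀ i, IsFracSeq a (τ i)) :
    ∃ (B : Type) (_ : Fintype B) (e : B → ℕ → M) (q : ι → B → fracSubring a),
      (∀ᶠ n in atTop, PIndep p fun b => e b n) ∧
      ∀ᶠ n in atTop, ∀ i, τ i n = ∑ b, (q i b : ℕ → M) n ^ p * e b n := by
  choose σ ρ hσ hρ h0 hτ using hτ
  obtain ⟨B, hB, e, q, hq, he, hexp⟩ := IsCombSeq.exists_pIndep_expansion ha p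
    (σ := fun i => σ i * ρ i ^ (p - 1))
    fun i => (combSubring a).mul_mem (hσ i) ((combSubring a).pow_mem (hρ i) _)
  refine ⟨B, hB, e, fun i b => ⟨q i b * fun n => (ρ i n)⁻¹,
    (fracSubring a).mul_mem (hq i b).isFracSeq ((hρ i).isFracSeq.inv ha)⟩, he, ?_⟩
  filter_upwards [hexp, eventually_all.2 hτ, eventually_all.2 h0] with n hn hτ h0 i
  have h1 : σ i n * ρ i n ^ (p - 1) = _ := hn i
  have h2 : τ i n = σ i n * ρ i n ^ (p - 1) * ((ρ i n)⁻¹) ^ p := by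
    obtain ⟨m, hm⟩ : ∃ m, p = m + 1 := ⟨p - 1, (Nat.sub_add_cancel (expChar_pos M p)).symm⟩
    rw [hτ, hm, Nat.add_sub_cancel]
    have := h0 i
    rw [inv_pow]
    field_simp
    ring
  rw [h2, h1, Finset.sum_mul]
  refine Finset.sum_congr rfl fun b _ => ?_
  simp only [Pi.mul_apply, mul_pow]
  ring

theorem sum_pow_mul_expansion {β γ : Type*} [Fintype β] [Fintype γ] (p : ℕ) [ExpChar M p]
    (c : β → M) (q : β → γ → M) (e : γ → M) :
    ∑ i, c i ^ p * ∑ b, q i b ^ p * e b = ∑ b, (∑ i, c i * q i b) ^ p * e b := by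
  simp only [sum_pow_expChar_eq, Finset.sum_mul, Finset.mul_sum, mul_pow, mul_assoc]
  exact Finset.sum_comm

theorem PIndep.of_expansion {β γ : Type*} [Fintype β] [Fintype γ] {p : ℕ} [ExpChar M p]
    {e : γ → M} (he : PIndep p e) {q : β → γ → M} (hq : LinearIndependent M q) {v : β → M}
    (hv : ∀ i, v i = ∑ b, q i b ^ p * e b) : PIndep p v := by
  intro c hc
  simp only [hv, sum_pow_mul_expansion] at hc
  refine Fintype.linearIndependent_iff.1 hq c (funext fun b => ?_)
  simpa using he _ hc b

theorem IsFracSeq.pIndep_and_exists_sum_dichotomy [Fintype ι] (ha : LamIndiscernible M a)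
    (p : ℕ) [ExpChar M p] {v : ι → ℕ → M} {t : ℕ → M} (hv : ∀ i, IsFracSeq a (v i))
    (ht : IsFracSeq a t) :
    (∀ᶠ n in atTop, ¬((PIndep p fun i => v i n) ∧ ∃ c : ι → M, t n = ∑ i, c i ^ p * v i n)) ∨
    ∃ r : ι → ℕ → M, (∀ i, IsFracSeq a (r i)) ∧
      ∀ᶠ n in atTop, (PIndep p fun i => v i n) ∧ t n = ∑ i, r i n ^ p * v i n := by
  obtain ⟨B, hB, e, q, he, hexp⟩ := IsFracSeq.exists_pIndep_expansion ha p
    (τ := fun o : Option ι => o.elim t v) (Option.rec ht hv)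
  have := isMaximal_evZeroIdeal ha
  let := Ideal.Quotient.field (evZeroIdeal a)
  let π := Ideal.Quotient.mk (evZeroIdeal a)
  have hcoe : ∀ (r : ι → fracSubring a) b n, ((∑ i, r i * q (some i) b : fracSubring a) : ℕ → M) n
      = ∑ i, (r i : ℕ → M) n * (q (some i) b : ℕ → M) n := fun r b n => by
    rw [AddSubmonoidClass.coe_finsetSum, Finset.sum_apply]
    rfl
  have hvexp : ∀ᶠ n in atTop, ∀ i, v i n = ∑ b, (q (some i) b : ℕ → M) n ^ p * e b n := by
    filter_upwards [hexp] with n hn i using hn (some i)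
  by_cases hli : LinearIndependent (fracSubring a ⧸ evZeroIdeal a) fun i b => π (q (some i) b)
  · have hvind : ∀ᶠ n in atTop, PIndep p fun i => v i n := by
      filter_upwards [eventually_linearIndependent ha _ hli, he, hvexp] with n h1 h2 h3
      exact h2.of_expansion h1 h3
    by_cases hmem : (fun b => π (q none b)) ∈
        Submodule.span (fracSubring a ⧸ evZeroIdeal a) (Set.range fun i b => π (q (some i) b))
    · right
      obtain ⟨r, hr⟩ := (Submodule.mem_span_range_iff_exists_fun _).1 hmem
      choose r' hr' using fun i => Ideal.Quotient.mk_surjective (I := evZeroIdeal a) (r i)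
      refine ⟨fun i => r' i, fun i => (r' i).2, ?_⟩
      have hq : ∀ᶠ n in atTop, ∀ b, (q none b : ℕ → M) n =
          ∑ i, (r' i : ℕ → M) n * (q (some i) b : ℕ → M) n := by
        refine eventually_all.2 fun b => ?_
        have h1 : π (q none b) = π (∑ i, r' i * q (some i) b) := by
          rw [map_sum]
          simpa [π, hr'] using (congrFun hr b).symm
        filter_upwards [mk_evZeroIdeal_eq_iff.1 h1] with n hn
        rw [hn, hcoe]
      filter_upwards [hvind, hexp, hvexp, hq] with n h1 h2 h3 h4
      refine ⟨h1, ?_⟩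
      simp only [h3, sum_pow_mul_expansion, ← h4]
      exact h2 none
    · left
      have hopt : LinearIndependent (fracSubring a ⧸ evZeroIdeal a) fun o b => π (q o b) :=
        linearIndependent_option.2 ⟨hli, hmem⟩
      filter_upwards [eventually_linearIndependent ha _ hopt, he, hexp] with n h1 h2 h3
      rintro ⟨-, c, hc⟩
      have h4 := (h2.of_expansion h1 h3) (fun o => o.elim (-1) c) (by
        rw [Fintype.sum_option]
        simp only [Option.elim_none, Option.elim_some, hc]
        rw [neg_one_pow_expChar, neg_one_mul, neg_add_cancel]) none
      simp at h4
  · left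
    obtain ⟨r, hr, i, hi⟩ := Fintype.not_linearIndependent_iff.1 hli
    choose r' hr' using fun i => Ideal.Quotient.mk_surjective (I := evZeroIdeal a) (r i)
    have h0 : ∀ᶠ n in atTop, (r' i : ℕ → M) n ≠ 0 := by
      refine (IsFracSeq.eventually_eq_zero_or_ne_zero ha (r' i).2).resolve_left fun h => hi ?_
      rw [← hr']
      exact Ideal.Quotient.eq_zero_iff_mem.2 h
    have hq : ∀ᶠ n in atTop, ∀ b, ∑ i, (r' i : ℕ → M) n * (q (some i) b : ℕ → M) n = 0 := by
      refine eventually_all.2 fun b => ?_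
      have h1 : π (∑ i, r' i * q (some i) b) = π 0 := by
        rw [map_sum]
        simpa [π, hr'] using congrFun hr b
      filter_upwards [mk_evZeroIdeal_eq_iff.1 h1] with n hn
      rw [← hcoe, hn]
      rfl
    filter_upwards [h0, hvexp, hq] with n h1 h2 h3
    rintro ⟨hind, -⟩
    refine h1 (hind (fun i => (r' i : ℕ → M) n) ?_ i)
    simp only [h2, sum_pow_mul_expansion, h3, zero_pow (expChar_ne_zero M p), zero_mul,
      Finset.sum_const_zero]

end Fractions

section Resolution

open Filter

variable {M : Type} [Field M] {N : ℕ} {a : ℕ → Fin N → M}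

theorem IsFracSeq.lamFun (ha : LamIndiscernible M a) {m : ℕ} (mm : Fin m → ℕ) {t : ℕ → M}
    {x : Fin m → ℕ → M} (ht : IsFracSeq a t) (hx : ∀ i, IsFracSeq a (x i)) :
    IsFracSeq a fun n => lamFun M mm (t n) fun i => x i n := by
  have := expChar_pexp M
  have hmon : ∀ k : Mon M m, IsFracSeq a fun n => monVal (fun i => x i n) k := fun k => by
    have h : (∏ i, x i ^ (k i : ℕ)) ∈ fracSubring a :=
      prod_mem fun i _ => pow_mem (hx i) _
    have h' : (fun n => monVal (fun i => x i n) k) = ∏ i, x i ^ (k i : ℕ) := by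
      ext n
      simp [monVal]
    rw [h']
    exact h
  by_cases hmm : ∀ i, mm i < pexp M
  · rcases IsFracSeq.pIndep_and_exists_sum_dichotomy ha (pexp M) hmon ht with h | ⟨r, hr, h⟩
    · refine IsFracSeq.congr (fracSubring a).zero_mem ?_
      filter_upwards [h] with n hn
      exact dif_neg fun h' => hn h'.2
    · refine (hr fun i => ⟨mm i, hmm i⟩).congr ?_
      filter_upwards [h] with n hn
      have hc : (∀ i, mm i < pexp M) ∧ MonPIndep (fun i => x i n) ∧
          InPSpan (t n) (fun i => x i n) := ⟨hmm, hn.1, fun k => r k n, hn.2⟩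
      have heq := (Classical.choose_spec hc.2.2).symm.trans hn.2
      exact (dif_pos hc).trans (congrFun (hn.1.injective heq) _)
  · refine IsFracSeq.congr (fracSubring a).zero_mem ?_
    exact Eventually.of_forall fun n => dif_neg fun h' => hmm h'.1

theorem isFracSeq_lamTermRealize (ha : LamIndiscernible M a) {r : ℕ} (b : Fin r → M)
    (t : lamRingLang.Term (Fin N ⊕ Fin r)) :
    IsFracSeq a fun n => lamTermRealize (Sum.elim (a n) b) t := by
  induction t with
  | var i =>
    rcases i with i | i
    · exact (IsDefSeq.coord i).isCombSeq.isFracSeq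
    · exact (isCombSeq_const (b i)).isFracSeq
  | @func k f ts ih =>
    rcases f with f | f
    · cases f with
      | add => exact (fracSubring a).add_mem (ih 0) (ih 1)
      | mul => exact (fracSubring a).mul_mem (ih 0) (ih 1)
      | neg => exact (fracSubring a).neg_mem (ih 0)
      | zero => exact (fracSubring a).zero_mem
      | one => exact (fracSubring a).one_mem
    · match k, f, ts, ih with
      | 0, f, _, _ => exact f.elim
      | 1, f, _, _ => exact f.elim
      | _ + 2, f, ts, ih => exact IsFracSeq.lamFun ha f (ih 0) fun i => ih i.succ

theorem IsDefFun.lamDefinableFun {l : ℕ} {h : (Fin N ⊕ Fin l × Fin N → M) → M}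
    (hh : IsDefFun h) :
    LamDefinableFun M N l fun u v => h (Sum.elim u fun q => v q.1 q.2) := by
  obtain ⟨φ, hφ⟩ := hh
  exact ⟨φ, fun u v y => hφ _⟩

end Resolution

/-- **Statement 8** (Indiscernible `λ`-resolution).  Let `M` be a `λ`-field of
characteristic exponent `p`, let `N ≥ 1`, let `(a_n)_{n<ω}` be an indiscernible sequence
of `N`-tuples of `M` and let `b` be a finite tuple of parameters from `M`.  For every
`L_λ`-term `t(x, y)` there exist a rational function `f = P/Q` over the prime field, a
natural number `l`, an indiscernible sequence `(α_n)_{n ≥ l}` of tuples of `M` and a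
finite tuple `d` of parameters from `M` such that:
(1) every coordinate of `α_n` is, uniformly in `n ≥ l`, given by a `0`-definable function
evaluated at `(a_n, a_{<l})`; and
(2) `t(a_n, b) = f(α_n, d)` for all sufficiently large `n ≥ l`. -/
theorem indiscernible_lambda_resolution
    (M : Type) [Field M] (N : ℕ) (hN : 1 ≤ N)
    (a : ℕ → Fin N → M) (ha : LamIndiscernible M a)
    (r : ℕ) (b : Fin r → M)
    (t : lamRingLang.Term (Fin N ⊕ Fin r)) :
    ∃ (k e : ℕ) (P Q : MvPolynomial (Fin k ⊕ Fin e) ℤ) (l : ℕ)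
      (α : ℕ → Fin k → M) (d : Fin e → M),
      LamIndiscernible M (fun n => α (l + n)) ∧
      (∀ j : Fin k, ∃ g : (Fin N → M) → (Fin l → Fin N → M) → M,
        LamDefinableFun M N l g ∧
          ∀ n, l ≤ n → α n j = g (a n) (fun i => a i)) ∧
      ∃ n₀ : ℕ, l ≤ n₀ ∧ ∀ n, n₀ ≤ n →
        lamTermRealize (Sum.elim (a n) b) t =
          MvPolynomial.aeval (Sum.elim (α n) d) P / MvPolynomial.aeval (Sum.elim (α n) d) Q := by
  obtain ⟨σ, ρ, ⟨k₁, s, d, hs, hσ⟩, ⟨k₂, s', d', hs', hρ⟩, -, ht⟩ :=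
    isFracSeq_lamTermRealize ha b t
  obtain ⟨n₀, hn₀⟩ := Filter.eventually_atTop.1 ht
  have happ : ∀ i, IsDefSeq a (Fin.append s s' i) := by
    intro i
    refine Fin.addCases (fun i => ?_) (fun i => ?_) i
    · rw [Fin.append_left]
      exact hs i
    · rw [Fin.append_right]
      exact hs' i
  obtain ⟨l, hl⟩ := exists_isDefSeqFrom happ
  refine ⟨k₁ + k₂, k₁ + k₂,
    ∑ i : Fin k₁, MvPolynomial.X (Sum.inl (Fin.castAdd k₂ i)) *
      MvPolynomial.X (Sum.inr (Fin.castAdd k₂ i)),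
    ∑ i : Fin k₂, MvPolynomial.X (Sum.inl (Fin.natAdd k₁ i)) *
      MvPolynomial.X (Sum.inr (Fin.natAdd k₁ i)),
    l, fun n i => Fin.append s s' i n, Fin.append d d',
    isIndiscernible_of_isDefSeqFrom ha hl, fun j => ?_, max l n₀, le_max_left _ _,
    fun n hn => ?_⟩
  · obtain ⟨h, hh, hsh⟩ := hl j
    exact ⟨_, hh.lamDefinableFun, hsh⟩
  · refine (hn₀ n (le_trans (le_max_right _ _) hn)).trans ?_
    rw [hσ, hρ]
    simp

end NIPPaper
end
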